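/- arXiv:math/0408382 — 3 statements merged into one kernel-verified Lean document; each statement's English description precedes it below -/
import Mathlib

section
/- Let g ≥ 2. The fundamental system {η₁,…,η_{2g+2}} produced by the construction (η_k := η_{T_k∘U} with T_k := {i₁,…,i_g}∖{i_k} for 1 ≤ k ≤ g and T_k := {i₁,…,i_g}∪{i_k} for g+1 ≤ k ≤ 2g+2) depends only on the unordered g-element subset {i₁,…,i_g} of {1,…,2g+2}: two permutations of (1,…,2g+2) with the same set of first g entries yield the same fundamental system, permutations with distinct sets of first g entries yield distinct fundamental systems, and consequently the set 𝓕 of all fundamental systems so obtained has cardinality binom(2g+2, g). -/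
open scoped Classical BigOperators

noncomputable section

/-- An analytic theta characteristic in dimension `g`: a pair `[η'; η'']` of
vectors in `ℝ^g` (whose entries are intended to lie in `{0, 1/2}`). -/
abbrev ThetaChar (g : ℕ) : Type := (Fin g → ℝ) × (Fin g → ℝ)

/-- All entries of both vectors of the characteristic lie in `{0, 1/2}`. -/
def IsChar {g : ℕ} (η : ThetaChar g) : Prop :=
  (∀ i, η.1 i = 0 ∨ η.1 i = 1 / 2) ∧ (∀ i, η.2 i = 0 ∨ η.2 i = 1 / 2)

/-- Membership in the Siegel upper half-space `H_g`: a symmetric complex `g×g`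
matrix whose imaginary part is positive definite. -/
def IsSiegel {g : ℕ} (τ : Matrix (Fin g) (Fin g) ℂ) : Prop :=
  τ.IsSymm ∧ (τ.map Complex.im).PosDef

/-- The theta function with characteristic `η`:
`θ[η](z;τ) = ∑_{n ∈ ℤ^g} exp(πi·ᵗ(n+η')τ(n+η') + 2πi·ᵗ(n+η')(z+η''))`. -/
def theta {g : ℕ} (η : ThetaChar g) (z : Fin g → ℂ)
    (τ : Matrix (Fin g) (Fin g) ℂ) : ℂ :=
  ∑' n : Fin g → ℤ,
    Complex.exp
      ((Real.pi : ℂ) * Complex.I *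
          ∑ i, ∑ j, ((n i : ℂ) + (η.1 i : ℂ)) * τ i j * ((n j : ℂ) + (η.1 j : ℂ)) +
        2 * (Real.pi : ℂ) * Complex.I *
          ∑ i, ((n i : ℂ) + (η.1 i : ℂ)) * (z i + (η.2 i : ℂ)))

/-- `η` is an even characteristic: `4·ᵗη'η''` is an even integer. -/
def IsEvenChar {g : ℕ} (η : ThetaChar g) : Prop :=
  ∃ k : ℤ, (4 * ∑ i, η.1 i * η.2 i : ℝ) = 2 * (k : ℝ)

/-- `η` is an odd characteristic. -/
def IsOddChar {g : ℕ} (η : ThetaChar g) : Prop := ¬ IsEvenChar η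

/-- Entrywise sum of two characteristics, taken modulo 1. -/
def charAdd {g : ℕ} (η ζ : ThetaChar g) : ThetaChar g :=
  (fun i => Int.fract (η.1 i + ζ.1 i), fun i => Int.fract (η.2 i + ζ.2 i))

/-- Entrywise difference of two characteristics, taken modulo 1. -/
def charSub {g : ℕ} (η ζ : ThetaChar g) : ThetaChar g :=
  (fun i => Int.fract (η.1 i - ζ.1 i), fun i => Int.fract (η.2 i - ζ.2 i))

/-- The Jacobian Nullwert `J(η₁,…,η_g)(τ)`: the determinant of the matrix of
partial derivatives `∂θ[η_k]/∂z_l` at `z = 0`. -/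
def jacobianNullwert {g : ℕ} (η : Fin g → ThetaChar g)
    (τ : Matrix (Fin g) (Fin g) ℂ) : ℂ :=
  Matrix.det (Matrix.of fun k l : Fin g =>
    fderiv ℂ (fun z : Fin g → ℂ => theta (η k) z τ) 0 (Pi.single l 1))

/-- The sign `e(η)`: `+1` if `η` is even, `-1` if odd. -/
def eSign {g : ℕ} (η : ThetaChar g) : ℤ := if IsEvenChar η then 1 else -1

/-- The triple `{a,b,c}` is azygetic: `e(a)e(b)e(c)e(a+b+c) = -1`. -/
def Azygetic {g : ℕ} (a b c : ThetaChar g) : Prop :=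
  eSign a * eSign b * eSign c * eSign (charAdd (charAdd a b) c) = -1

/-- A fundamental system of analytic theta characteristics: a set of `2g+2`
characteristics, `g` of them odd and the remaining `g+2` even, such that every
three-element subset is azygetic. -/
def IsFundamentalSystem (g : ℕ) (F : Finset (ThetaChar g)) : Prop :=
  F.card = 2 * g + 2 ∧ (∀ η ∈ F, IsChar η) ∧
    (F.filter fun η => IsOddChar η).card = g ∧
    ∀ a ∈ F, ∀ b ∈ F, ∀ c ∈ F, a ≠ b → a ≠ c → b ≠ c → Azygetic a b c

/-- The basic characteristic `η_k` for `1 ≤ k ≤ 2g+2`: for `k = 2k'-1` odd the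
top vector has `1/2` in the `k'`-th entry (zero vector if `k' = g+1`) and the
bottom vector has `1/2` in the first `k'-1` entries; for `k = 2k'` even the top
vector has `1/2` in the `k'`-th entry and the bottom vector has `1/2` in the
first `k'` entries. -/
def etaBase (g k : ℕ) : ThetaChar g :=
  (fun i => if (i : ℕ) + 1 = (k + 1) / 2 then 1 / 2 else 0,
   fun i => if (i : ℕ) < k / 2 then 1 / 2 else 0)

/-- `η_S := ∑_{k ∈ S, k ≠ 2g+2} η_k`, the sum taken entrywise modulo 1. -/
def etaSet (g : ℕ) (S : Finset ℕ) : ThetaChar g :=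
  (fun i => Int.fract (∑ k ∈ S.erase (2 * g + 2), (etaBase g k).1 i),
   fun i => Int.fract (∑ k ∈ S.erase (2 * g + 2), (etaBase g k).2 i))

/-- `U = {1, 3, …, 2g+1}`. -/
def Uset (g : ℕ) : Finset ℕ := (Finset.range (g + 1)).image fun j => 2 * j + 1

/-- `i` represents a permutation `(i₁,…,i_{2g+2})` of `(1,…,2g+2)`. -/
def IsPermIndex (g : ℕ) (i : Fin (2 * g + 2) → ℕ) : Prop :=
  Function.Injective i ∧ Finset.image i Finset.univ = Finset.Icc 1 (2 * g + 2)

/-- Given a permutation `(i₁,…,i_{2g+2})` of `(1,…,2g+2)`, the characteristic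
`η_k := η_{T_k ∘ U}` where `T_k = {i₁,…,i_g} ∖ {i_k}` for `1 ≤ k ≤ g` and
`T_k = {i₁,…,i_g} ∪ {i_k}` for `g+1 ≤ k ≤ 2g+2`. -/
def fsChars (g : ℕ) (i : Fin (2 * g + 2) → ℕ) : Fin (2 * g + 2) → ThetaChar g :=
  fun k =>
    let T0 : Finset ℕ :=
      Finset.image i (Finset.univ.filter fun l : Fin (2 * g + 2) => (l : ℕ) < g)
    if (k : ℕ) < g then etaSet g (symmDiff (T0.erase (i k)) (Uset g))
    else etaSet g (symmDiff (insert (i k) T0) (Uset g))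

/-- The system of `2g+2` characteristics obtained from a permutation
`(i₁,…,i_{2g+2})` of `(1,…,2g+2)`. -/
def fsSystem (g : ℕ) (i : Fin (2 * g + 2) → ℕ) : Finset (ThetaChar g) :=
  Finset.image (fsChars g i) Finset.univ

/-- The family `𝓕` of all fundamental systems obtained from permutations of
`(1,…,2g+2)`. -/
def FSfamily (g : ℕ) : Set (Finset (ThetaChar g)) :=
  {F | ∃ i : Fin (2 * g + 2) → ℕ, IsPermIndex g i ∧ F = fsSystem g i}

/-- The mod-2 indicator of a set of indices. -/
def indicatorTwo (S : Finset ℕ) (k : ℕ) : ZMod 2 := if k ∈ S then 1 else 0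

theorem sum_cast_eq_of_fract_eq {s t : Finset ℕ} {p : ℕ → Prop} [DecidablePred p]
    (h : Int.fract (∑ k ∈ s, if p k then (1 / 2 : ℝ) else 0) =
      Int.fract (∑ k ∈ t, if p k then (1 / 2 : ℝ) else 0)) :
    (∑ k ∈ s, if p k then (1 : ZMod 2) else 0) = ∑ k ∈ t, if p k then 1 else 0 := by
  simp only [← Finset.sum_filter, Finset.sum_const, nsmul_eq_mul, mul_one] at h ⊢
  obtain ⟨z, hz⟩ := Int.fract_eq_fract.mp h
  have hz' : ((s.filter p).card : ℤ) = (t.filter p).card + 2 * z := by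
    have : ((s.filter p).card : ℝ) = (t.filter p).card + 2 * z := by linarith
    exact_mod_cast this
  have h2 := congrArg (Int.cast : ℤ → ZMod 2) hz'
  have two_eq_zero : (2 : ZMod 2) = 0 := rfl
  push_cast at h2
  simpa [two_eq_zero] using h2

theorem sum_erase_eq_sum_indicatorTwo {g : ℕ} {S : Finset ℕ} (hS : S ⊆ Finset.Icc 1 (2 * g + 2))
    (p : ℕ → Prop) [DecidablePred p] :
    (∑ k ∈ S.erase (2 * g + 2), if p k then (1 : ZMod 2) else 0) =
      ∑ k ∈ Finset.Icc 1 (2 * g + 1), if p k then indicatorTwo S k else 0 := by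
  have hsub : S.erase (2 * g + 2) = (Finset.Icc 1 (2 * g + 1)).filter (· ∈ S) := by
    ext k
    have := @hS k
    simp only [Finset.mem_erase, Finset.mem_filter, Finset.mem_Icc] at this ⊢
    constructor
    · rintro ⟨h1, h2⟩
      have := this h2
      exact ⟨by omega, h2⟩
    · rintro ⟨h1, h2⟩
      exact ⟨by omega, h2⟩
  rw [hsub, Finset.sum_filter]
  refine Finset.sum_congr rfl fun k _ => ?_
  unfold indicatorTwo
  split_ifs <;> rfl

theorem card_eq_sum_indicatorTwo {n : ℕ} {S : Finset ℕ} (hS : S ⊆ Finset.Icc 1 n) :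
    (S.card : ZMod 2) = ∑ k ∈ Finset.Icc 1 n, indicatorTwo S k := by
  unfold indicatorTwo
  rw [← Finset.sum_filter, Finset.filter_mem_eq_inter, Finset.inter_eq_right.mpr hS]
  simp

theorem eq_apply_one_of_filtered_sums_eq_zero {g : ℕ} (y : ℕ → ZMod 2)
    (htop : ∀ i < g, (∑ k ∈ Finset.Icc 1 (2 * g + 1), if i + 1 = (k + 1) / 2 then y k else 0) = 0)
    (hbot : ∀ i < g, (∑ k ∈ Finset.Icc 1 (2 * g + 1), if i < k / 2 then y k else 0) = 0) :
    ∀ k ≤ 2 * g, y (k + 1) = y 1 := by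
  have add_zero_eq : ∀ a b : ZMod 2, a + b = 0 → b = a := by decide
  have hodd : ∀ i < g, y (2 * i + 2) = y (2 * i + 1) := by
    intro i hi
    have h := htop i hi
    rw [← Finset.sum_filter, show (Finset.Icc 1 (2 * g + 1)).filter
      (fun k => i + 1 = (k + 1) / 2) = {2 * i + 1, 2 * i + 2} by
        ext k; simp only [Finset.mem_filter, Finset.mem_Icc, Finset.mem_insert,
          Finset.mem_singleton]; omega, Finset.sum_pair (by omega)] at h
    exact add_zero_eq _ _ h
  have htail : ∀ i ≤ g, ∑ k ∈ Finset.Ico (2 * i + 2) (2 * g + 2), y k = 0 := by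
    intro i hi
    rcases hi.lt_or_eq with hi | rfl
    · have h := hbot i hi
      rwa [← Finset.sum_filter, show (Finset.Icc 1 (2 * g + 1)).filter
        (fun k => i < k / 2) = Finset.Ico (2 * i + 2) (2 * g + 2) by
          ext k; simp only [Finset.mem_filter, Finset.mem_Icc, Finset.mem_Ico]; omega] at h
    · simp
  have heven : ∀ i < g, y (2 * i + 3) = y (2 * i + 2) := by
    intro i hi
    have h := htail i hi.le
    rw [Finset.sum_eq_sum_Ico_succ_bot (by omega), Finset.sum_eq_sum_Ico_succ_bot (by omega)] at h
    have h' := htail (i + 1) hi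
    rw [show 2 * (i + 1) + 2 = 2 * i + 2 + 1 + 1 by ring] at h'
    rw [h', add_zero] at h
    exact add_zero_eq _ _ h
  intro k
  induction k with
  | zero => intro _; rfl
  | succ k ih =>
    intro hk
    rw [← ih (by omega)]
    obtain ⟨m, rfl | rfl⟩ := Nat.even_or_odd' k
    · exact hodd m (by omega)
    · exact heven m (by omega)

/-- On index sets of equal parity, `S ↦ η_S` is injective up to complementation. -/
theorem symmDiff_eq_empty_or_of_etaSet_eq {g : ℕ} {S S' : Finset ℕ}
    (hS : S ⊆ Finset.Icc 1 (2 * g + 2)) (hS' : S' ⊆ Finset.Icc 1 (2 * g + 2))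
    (hcard : (S.card : ZMod 2) = S'.card) (h : etaSet g S = etaSet g S') :
    symmDiff S S' = ∅ ∨ symmDiff S S' = Finset.Icc 1 (2 * g + 2) := by
  set y : ℕ → ZMod 2 := fun k => indicatorTwo S k - indicatorTwo S' k with hy
  have hsum : ∀ (p : ℕ → Prop) [DecidablePred p],
      Int.fract (∑ k ∈ S.erase (2 * g + 2), if p k then (1 / 2 : ℝ) else 0) =
        Int.fract (∑ k ∈ S'.erase (2 * g + 2), if p k then (1 / 2 : ℝ) else 0) →
      (∑ k ∈ Finset.Icc 1 (2 * g + 1), if p k then y k else 0) = 0 := by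
    intro p _ hp
    have h1 := sum_cast_eq_of_fract_eq hp
    rw [sum_erase_eq_sum_indicatorTwo hS, sum_erase_eq_sum_indicatorTwo hS'] at h1
    rw [← sub_eq_zero, ← Finset.sum_sub_distrib] at h1
    refine (Finset.sum_congr rfl fun k _ => ?_).trans h1
    split_ifs <;> simp [hy]
  have hconst : ∀ k ≤ 2 * g, y (k + 1) = y 1 := by
    apply eq_apply_one_of_filtered_sums_eq_zero
    · intro i hi
      exact hsum (fun k => i + 1 = (k + 1) / 2) (congrFun (congrArg Prod.fst h) ⟨i, hi⟩)
    · intro i hi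
      exact hsum (fun k => i < k / 2) (congrFun (congrArg Prod.snd h) ⟨i, hi⟩)
  have htotal : ∑ k ∈ Finset.range (2 * g + 2), y (k + 1) = 0 := by
    rw [card_eq_sum_indicatorTwo hS, card_eq_sum_indicatorTwo hS', ← sub_eq_zero,
      ← Finset.sum_sub_distrib, ← Finset.Ico_add_one_right_eq_Icc,
      Finset.sum_Ico_eq_sum_range] at hcard
    simpa [hy, add_comm] using hcard
  have hlast : y (2 * g + 2) = y 1 := by
    rw [Finset.sum_range_succ, Finset.sum_congr rfl (g := fun _ => y 1)
      (fun k hk => hconst k (by rw [Finset.mem_range] at hk; omega))] at htotal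
    have two_eq_zero : (2 : ZMod 2) = 0 := rfl
    simp only [Finset.sum_const, Finset.card_range, nsmul_eq_mul, Nat.cast_add, Nat.cast_mul,
      Nat.cast_ofNat, two_eq_zero, zero_mul, zero_add, Nat.cast_one, one_mul] at htotal
    exact (by decide : ∀ a b : ZMod 2, a + b = 0 → b = a) _ _ htotal
  have hall : ∀ k ∈ Finset.Icc 1 (2 * g + 2), y k = y 1 := by
    intro k hk
    rw [Finset.mem_Icc] at hk
    rcases hk.2.lt_or_eq with h' | rfl
    · obtain ⟨m, rfl⟩ := Nat.exists_eq_add_of_le' hk.1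
      exact hconst m (by omega)
    · exact hlast
  have hmem : ∀ k, k ∈ symmDiff S S' ↔ y k ≠ 0 := by
    intro k
    simp only [hy, indicatorTwo, Finset.mem_symmDiff]
    by_cases h1 : k ∈ S <;> by_cases h2 : k ∈ S' <;> simp [h1, h2]
  have hsub : symmDiff S S' ⊆ Finset.Icc 1 (2 * g + 2) := by
    intro k hk
    rcases Finset.mem_symmDiff.mp hk with hk | hk
    exacts [hS hk.1, hS' hk.1]
  by_cases h1 : y 1 = 0
  · left
    refine Finset.eq_empty_of_forall_notMem fun k hk => (hmem k).mp hk ?_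
    rw [hall k (hsub hk), h1]
  · right
    refine hsub.antisymm fun k hk => (hmem k).mpr ?_
    rwa [hall k hk]

theorem cast_card_symmDiff (S T : Finset ℕ) :
    ((symmDiff S T).card : ZMod 2) = S.card + T.card := by
  have h1 : (symmDiff S T).card = (S \ T).card + (T \ S).card := by
    rw [Finset.symmDiff_def, Finset.card_union_of_disjoint disjoint_sdiff_sdiff]
  have h2 := Finset.card_sdiff_add_card_inter S T
  have h3 := Finset.card_sdiff_add_card_inter T S
  rw [Finset.inter_comm] at h3
  have two_eq_zero : (2 : ZMod 2) = 0 := rfl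
  rw [h1, ← h2, ← h3]
  push_cast
  linear_combination (-((S ∩ T).card : ZMod 2)) * two_eq_zero

theorem Uset_subset (g : ℕ) : Uset g ⊆ Finset.Icc 1 (2 * g + 2) := by
  intro k hk
  simp only [Uset, Finset.mem_image, Finset.mem_range, Finset.mem_Icc] at hk ⊢
  omega

theorem symmDiff_subset_of_subset {S T X : Finset ℕ} (hS : S ⊆ X) (hT : T ⊆ X) :
    symmDiff S T ⊆ X :=
  symmDiff_le_sup.trans (sup_le hS hT)

/-- The system of characteristics attached to an index set `A`. -/
def systemOfSet (g : ℕ) (A : Finset ℕ) : Finset (ThetaChar g) :=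
  (Finset.Icc 1 (2 * g + 2)).image fun a => etaSet g (symmDiff (symmDiff A {a}) (Uset g))

theorem mem_image_lt_iff {g : ℕ} {i : Fin (2 * g + 2) → ℕ} (hi : Function.Injective i)
    (k : Fin (2 * g + 2)) :
    i k ∈ Finset.image i (Finset.univ.filter fun l : Fin (2 * g + 2) => (l : ℕ) < g) ↔
      (k : ℕ) < g := by
  simp [hi.eq_iff]

theorem fsSystem_eq_systemOfSet {g : ℕ} {i : Fin (2 * g + 2) → ℕ} (hi : IsPermIndex g i) :
    fsSystem g i = systemOfSet g
      (Finset.image i (Finset.univ.filter fun l : Fin (2 * g + 2) => (l : ℕ) < g)) := by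
  rw [fsSystem, systemOfSet, ← hi.2, Finset.image_image]
  refine Finset.image_congr fun k _ => ?_
  have hk := mem_image_lt_iff hi.1 k
  simp only [fsChars, Function.comp]
  generalize Finset.image i (Finset.univ.filter fun l : Fin (2 * g + 2) => (l : ℕ) < g) = T at hk ⊢
  split_ifs with h
  · congr 2
    ext m
    by_cases hm : m = i k
    · subst hm; simp [Finset.mem_symmDiff, hk.mpr h]
    · simp [Finset.mem_symmDiff, hm]
  · congr 2
    ext m
    by_cases hm : m = i k
    · subst hm; simp [Finset.mem_symmDiff, mt hk.mp h]
    · simp [Finset.mem_symmDiff, hm]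

theorem image_lt_mem_powersetCard {g : ℕ} {i : Fin (2 * g + 2) → ℕ} (hi : IsPermIndex g i) :
    Finset.image i (Finset.univ.filter fun l : Fin (2 * g + 2) => (l : ℕ) < g) ∈
      Finset.powersetCard g (Finset.Icc 1 (2 * g + 2)) := by
  rw [Finset.mem_powersetCard, ← hi.2, Finset.card_image_of_injective _ hi.1,
    Fin.card_filter_val_lt]
  exact ⟨Finset.image_subset_image (Finset.subset_univ _), by omega⟩

theorem exists_permIndex {g : ℕ} {A : Finset ℕ}
    (hA : A ∈ Finset.powersetCard g (Finset.Icc 1 (2 * g + 2))) :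
    ∃ i : Fin (2 * g + 2) → ℕ, IsPermIndex g i ∧
      Finset.image i (Finset.univ.filter fun l : Fin (2 * g + 2) => (l : ℕ) < g) = A := by
  obtain ⟨hAsub, hAcard⟩ := Finset.mem_powersetCard.mp hA
  set s := Finset.univ.filter fun l : Fin (2 * g + 2) => (l : ℕ) < g with hs
  have hscard : s.card = A.card := by
    rw [hs, Fin.card_filter_val_lt, hAcard]
    omega
  obtain ⟨f, hf⟩ : ∃ f : Fin (2 * g + 2) → ℕ, Set.BijOn f s A :=
    s.finite_toSet.exists_bijOn_of_encard_eq (by simp [hscard])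
  have himage : s.image f = A := by
    apply Finset.coe_injective
    rw [Finset.coe_image, hf.image_eq]
  obtain ⟨e, he⟩ := Finset.exists_equiv_extend_of_card_eq (t := Finset.Icc 1 (2 * g + 2))
    (by simp) (himage.trans_subset hAsub) hf.injOn
  refine ⟨fun k => e k, ⟨Subtype.val_injective.comp e.injective, ?_⟩, ?_⟩
  · ext m
    simp only [Finset.mem_image, Finset.mem_univ, true_and]
    constructor
    · rintro ⟨k, rfl⟩
      exact (e k).2
    · intro hm
      exact ⟨e.symm ⟨m, hm⟩, by simp⟩
  · rw [← himage]
    exact Finset.image_congr he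

theorem systemOfSet_injOn {g : ℕ} (hg : 2 ≤ g) :
    Set.InjOn (systemOfSet g) (Finset.powersetCard g (Finset.Icc 1 (2 * g + 2)) : Set _) := by
  intro A hA B hB hAB
  obtain ⟨hAsub, hAcard⟩ := Finset.mem_powersetCard.mp (Finset.mem_coe.mp hA)
  obtain ⟨hBsub, hBcard⟩ := Finset.mem_powersetCard.mp (Finset.mem_coe.mp hB)
  by_contra hne
  set D := symmDiff A B with hD
  have hDsub : D ⊆ Finset.Icc 1 (2 * g + 2) := symmDiff_subset_of_subset hAsub hBsub
  have hDle : D.card ≤ 2 * g := by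
    have : D.card ≤ (A ∪ B).card := Finset.card_le_card symmDiff_le_sup
    have := Finset.card_union_le A B
    omega
  have hDne : D.Nonempty := by
    rw [Finset.nonempty_iff_ne_empty]
    exact fun h => hne (symmDiff_eq_bot.mp h)
  have key : ∀ a ∈ Finset.Icc 1 (2 * g + 2), ∃ b ∈ Finset.Icc 1 (2 * g + 2),
      D = symmDiff {a} {b} ∨ D = symmDiff (symmDiff {a} {b}) (Finset.Icc 1 (2 * g + 2)) := by
    intro a ha
    have hmem : etaSet g (symmDiff (symmDiff A {a}) (Uset g)) ∈ systemOfSet g B :=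
      hAB ▸ Finset.mem_image_of_mem _ ha
    obtain ⟨b, hb, hab⟩ := Finset.mem_image.mp hmem
    have hsub : ∀ {X : Finset ℕ} {c : ℕ}, X ⊆ Finset.Icc 1 (2 * g + 2) →
        c ∈ Finset.Icc 1 (2 * g + 2) →
        symmDiff (symmDiff X {c}) (Uset g) ⊆ Finset.Icc 1 (2 * g + 2) := fun hX hc =>
      symmDiff_subset_of_subset
        (symmDiff_subset_of_subset hX (Finset.singleton_subset_iff.mpr hc)) (Uset_subset g)
    have h := symmDiff_eq_empty_or_of_etaSet_eq (hsub hAsub ha) (hsub hBsub hb)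
      (by simp only [cast_card_symmDiff, hAcard, hBcard, Finset.card_singleton]) hab.symm
    have hrw : symmDiff (symmDiff (symmDiff A {a}) (Uset g)) (symmDiff (symmDiff B {b}) (Uset g)) =
        symmDiff D (symmDiff {a} {b}) := by
      rw [symmDiff_symmDiff_symmDiff_comm, symmDiff_self, symmDiff_bot,
        symmDiff_symmDiff_symmDiff_comm]
    rw [hrw] at h
    refine ⟨b, hb, h.imp (fun h => symmDiff_eq_bot.mp h) fun h => ?_⟩
    rw [← h, symmDiff_comm D, symmDiff_symmDiff_cancel_left]
  have hpair : ∀ a b : ℕ, (symmDiff {a} {b} : Finset ℕ).card ≤ 2 := by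
    intro a b
    exact (Finset.card_le_card symmDiff_le_sup).trans (Finset.card_union_le {a} {b})
  have hDtwo : D.card ≤ 2 := by
    obtain ⟨a, ha⟩ := hDne
    obtain ⟨b, hb, h | h⟩ := key a (hDsub ha)
    · rw [h]; exact hpair a b
    · have hab : a = b := by
        by_contra hab
        have ha' := hDsub ha
        rw [h, Finset.mem_symmDiff] at ha
        simp [Finset.mem_symmDiff, hab] at ha ha'
        omega
      rw [hab, symmDiff_self, bot_symmDiff] at h
      rw [h, Nat.card_Icc] at hDle
      omega
  obtain ⟨c, hc, hcD⟩ : ∃ c ∈ Finset.Icc 1 (2 * g + 2), c ∉ D := by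
    apply Finset.exists_mem_notMem_of_card_lt_card
    simp only [Nat.card_Icc]
    omega
  obtain ⟨b, hb, h | h⟩ := key c hc
  · have hbc : c = b := by
      by_contra hbc
      exact hcD (h ▸ by simp [Finset.mem_symmDiff, hbc])
    subst hbc
    simp [hDne.ne_empty] at h
  · have hIcc : Finset.Icc 1 (2 * g + 2) = symmDiff (symmDiff {c} {b}) D := by
      rw [h, symmDiff_symmDiff_cancel_left]
    have h1 := congrArg Finset.card hIcc
    have h2 : (symmDiff (symmDiff {c} {b}) D).card ≤ ((symmDiff {c} {b}) ∪ D).card :=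
      Finset.card_le_card symmDiff_le_sup
    have h3 := Finset.card_union_le (symmDiff {c} {b}) D
    have h4 := hpair c b
    simp only [Nat.card_Icc] at h1
    omega

theorem FSfamily_eq_image (g : ℕ) :
    FSfamily g =
      ((Finset.powersetCard g (Finset.Icc 1 (2 * g + 2))).image (systemOfSet g) : Set _) := by
  ext F
  simp only [FSfamily, Set.mem_ofPred_eq, Finset.coe_image, Set.mem_image, Finset.mem_coe]
  constructor
  · rintro ⟨i, hi, rfl⟩
    exact ⟨_, image_lt_mem_powersetCard hi, (fsSystem_eq_systemOfSet hi).symm⟩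
  · rintro ⟨A, hA, rfl⟩
    obtain ⟨i, hi, rfl⟩ := exists_permIndex hA
    exact ⟨i, hi, (fsSystem_eq_systemOfSet hi).symm⟩

/-- The fundamental system produced from a permutation `(i₁,…,i_{2g+2})` of
`(1,…,2g+2)` depends only on the unordered set `{i₁,…,i_g}` of its first `g`
entries: permutations with the same set of first `g` entries yield the same
system, permutations with distinct such sets yield distinct systems, and the
family `𝓕` of all systems so obtained has cardinality `binom(2g+2, g)`. -/
theorem fs_family_card (g : ℕ) (hg : 2 ≤ g) :
    (∀ i i' : Fin (2 * g + 2) → ℕ, IsPermIndex g i → IsPermIndex g i' →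
      Finset.image i (Finset.univ.filter fun l : Fin (2 * g + 2) => (l : ℕ) < g) =
        Finset.image i' (Finset.univ.filter fun l : Fin (2 * g + 2) => (l : ℕ) < g) →
      fsSystem g i = fsSystem g i') ∧
    (∀ i i' : Fin (2 * g + 2) → ℕ, IsPermIndex g i → IsPermIndex g i' →
      Finset.image i (Finset.univ.filter fun l : Fin (2 * g + 2) => (l : ℕ) < g) ≠
        Finset.image i' (Finset.univ.filter fun l : Fin (2 * g + 2) => (l : ℕ) < g) →
      fsSystem g i ≠ fsSystem g i') ∧
    (FSfamily g).ncard = (2 * g + 2).choose g := by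
  refine ⟨fun i i' hi hi' h => ?_, fun i i' hi hi' hne h => hne ?_, ?_⟩
  · rw [fsSystem_eq_systemOfSet hi, fsSystem_eq_systemOfSet hi', h]
  · rw [fsSystem_eq_systemOfSet hi, fsSystem_eq_systemOfSet hi'] at h
    exact systemOfSet_injOn hg (image_lt_mem_powersetCard hi) (image_lt_mem_powersetCard hi') h
  · rw [FSfamily_eq_image, Set.ncard_coe_finset, Finset.card_image_of_injOn (systemOfSet_injOn hg),
      Finset.card_powersetCard, Nat.card_Icc, Nat.add_sub_cancel]

end
end

section
/- Let g ≥ 2. For every subset T of {1,…,2g+1} of cardinality g+1, the analytic theta characteristic η_{T ∘ U} is even. -/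
open scoped Classical BigOperators

noncomputable section

lemma fract_natCast_div_two (n : ℕ) : Int.fract ((n : ℝ) / 2) = ((n % 2 : ℕ) : ℝ) / 2 := by
  have h : (n : ℝ) / 2 = ((n % 2 : ℕ) : ℝ) / 2 + ((n / 2 : ℕ) : ℝ) := by
    have := Nat.mod_add_div n 2
    have h' : (((n % 2 : ℕ) : ℝ)) + 2 * ((n / 2 : ℕ) : ℝ) = n := by exact_mod_cast this
    linarith
  rw [h, Int.fract_add_natCast, Int.fract_eq_self]
  have : ((n % 2 : ℕ) : ℝ) ≤ 1 := by exact_mod_cast (by omega : n % 2 ≤ 1)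
  constructor
  · positivity
  · linarith

lemma mem_Uset {g k : ℕ} : k ∈ Uset g ↔ k ≤ 2 * g + 1 ∧ k % 2 = 1 := by
  simp only [Uset, Finset.mem_image, Finset.mem_range]
  constructor
  · rintro ⟨j, hj, rfl⟩
    omega
  · rintro ⟨h1, h2⟩
    exact ⟨k / 2, by omega, by omega⟩

/-- The excess of `T` over `U` among the indices greater than `2 * j`. -/
def tailExcess (g : ℕ) (T : Finset ℕ) (j : ℕ) : ℤ :=
  ∑ k ∈ Finset.Icc (2 * j + 1) (2 * g + 1), ((if k ∈ T then 1 else 0) - ((k % 2 : ℕ) : ℤ))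

lemma tailExcess_self (g : ℕ) (T : Finset ℕ) :
    tailExcess g T g = (if 2 * g + 1 ∈ T then 1 else 0) - 1 := by
  rw [tailExcess, Finset.Icc_self, Finset.sum_singleton, show (2 * g + 1) % 2 = 1 by omega]
  rfl

lemma sum_mod_two_Icc (g : ℕ) : ∑ k ∈ Finset.Icc 1 (2 * g + 1), ((k % 2 : ℕ) : ℤ) = g + 1 := by
  induction g with
  | zero => simp
  | succ g ih =>
    rw [show 2 * (g + 1) + 1 = 2 * g + 1 + 1 + 1 by ring, Finset.sum_Icc_succ_top (by omega),
      Finset.sum_Icc_succ_top (by omega), ih, show (2 * g + 1 + 1) % 2 = 0 by omega,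
      show (2 * g + 1 + 1 + 1) % 2 = 1 by omega]
    push_cast
    ring

lemma tailExcess_zero {g : ℕ} {T : Finset ℕ} (hT : T ⊆ Finset.Icc 1 (2 * g + 1))
    (hcard : T.card = g + 1) : tailExcess g T 0 = 0 := by
  rw [tailExcess, mul_zero, zero_add, Finset.sum_sub_distrib, sum_mod_two_Icc,
    Finset.sum_ite_mem, Finset.inter_eq_right.mpr hT]
  simp [hcard]

lemma sum_Icc_eq_add_sum_Icc_succ {a b : ℕ} (h : a ≤ b) (f : ℕ → ℤ) :
    ∑ k ∈ Finset.Icc a b, f k = f a + ∑ k ∈ Finset.Icc (a + 1) b, f k := by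
  rw [← Finset.add_sum_Ioc_eq_sum_Icc h]
  congr 2
  ext k
  rw [Finset.mem_Ioc, Finset.mem_Icc, Nat.succ_le_iff]

lemma sum_Icc_even_start {g i : ℕ} (hi : i < g) (f : ℕ → ℤ) :
    ∑ k ∈ Finset.Icc (2 * i + 2) (2 * g + 1), f k =
      f (2 * i + 2) + ∑ k ∈ Finset.Icc (2 * (i + 1) + 1) (2 * g + 1), f k := by
  exact sum_Icc_eq_add_sum_Icc_succ (by omega) f

lemma tailExcess_succ {g i : ℕ} (hi : i < g) (T : Finset ℕ) :
    tailExcess g T i = tailExcess g T (i + 1) + (if 2 * i + 1 ∈ T then 1 else 0)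
      + (if 2 * i + 2 ∈ T then 1 else 0) - 1 := by
  have h : tailExcess g T i = ((if 2 * i + 1 ∈ T then 1 else 0) - (((2 * i + 1) % 2 : ℕ) : ℤ)) +
      ∑ k ∈ Finset.Icc (2 * i + 2) (2 * g + 1),
        ((if k ∈ T then 1 else 0) - ((k % 2 : ℕ) : ℤ)) :=
    sum_Icc_eq_add_sum_Icc_succ (by omega) _
  rw [h, sum_Icc_even_start hi, tailExcess, show (2 * i + 1) % 2 = 1 by omega,
    show (2 * i + 2) % 2 = 0 by omega]
  push_cast
  ring

/-- The index set over which `η_{T ∘ U}` is summed. -/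
lemma mem_symmDiff_Uset_erase {g k : ℕ} {T : Finset ℕ} (hT : T ⊆ Finset.Icc 1 (2 * g + 1)) :
    k ∈ (symmDiff T (Uset g)).erase (2 * g + 2) ↔
      k ∈ Finset.Icc 1 (2 * g + 1) ∧ (k ∈ T ↔ k % 2 = 0) := by
  have hk : k ∈ T → 1 ≤ k ∧ k ≤ 2 * g + 1 := fun h => Finset.mem_Icc.mp (hT h)
  rw [Finset.mem_erase, Finset.mem_symmDiff, mem_Uset, Finset.mem_Icc]
  by_cases h : k ∈ T
  · have := hk h
    simp only [h, true_and, not_true_eq_false, and_false, or_false, true_iff]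
    omega
  · simp only [h, false_and, not_false_eq_true, and_true, false_or, false_iff]
    omega

lemma etaSet_fst (g : ℕ) (S : Finset ℕ) (i : Fin g) :
    (etaSet g S).1 i =
      ((((S.erase (2 * g + 2)).filter fun k => (i : ℕ) + 1 = (k + 1) / 2).card % 2 : ℕ) : ℝ) / 2 := by
  rw [← fract_natCast_div_two]
  simp only [etaSet, etaBase]
  rw [← Finset.sum_filter, Finset.sum_const, nsmul_eq_mul, mul_one_div]

lemma etaSet_snd (g : ℕ) (S : Finset ℕ) (i : Fin g) :
    (etaSet g S).2 i =
      ((((S.erase (2 * g + 2)).filter fun k => (i : ℕ) < k / 2).card % 2 : ℕ) : ℝ) / 2 := by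
  rw [← fract_natCast_div_two]
  simp only [etaSet, etaBase]
  rw [← Finset.sum_filter, Finset.sum_const, nsmul_eq_mul, mul_one_div]

lemma card_filter_fst {g i : ℕ} (hi : i < g) {T : Finset ℕ}
    (hT : T ⊆ Finset.Icc 1 (2 * g + 1)) :
    (((symmDiff T (Uset g)).erase (2 * g + 2)).filter fun k => i + 1 = (k + 1) / 2).card =
      (if 2 * i + 1 ∈ T then 0 else 1) + (if 2 * i + 2 ∈ T then 1 else 0) := by
  have h : (((symmDiff T (Uset g)).erase (2 * g + 2)).filter fun k => i + 1 = (k + 1) / 2) =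
      ({2 * i + 1, 2 * i + 2} : Finset ℕ).filter fun k => (k ∈ T ↔ k % 2 = 0) := by
    ext k
    rw [Finset.mem_filter, mem_symmDiff_Uset_erase hT, Finset.mem_filter, Finset.mem_insert,
      Finset.mem_singleton, Finset.mem_Icc]
    constructor
    · rintro ⟨⟨h1, h2⟩, h3⟩
      exact ⟨by omega, h2⟩
    · rintro ⟨h1, h2⟩
      exact ⟨⟨by omega, h2⟩, by omega⟩
  rw [h, Finset.card_filter, Finset.sum_pair (by omega)]
  have h1 : (2 * i + 1) % 2 = 1 := by omega
  have h2 : (2 * i + 2) % 2 = 0 := by omega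
  simp only [h1, h2, one_ne_zero, iff_false, iff_true, ite_not]

lemma card_filter_snd {g i : ℕ} (hi : i < g) {T : Finset ℕ}
    (hT : T ⊆ Finset.Icc 1 (2 * g + 1)) :
    (2 : ℤ) ∣ ((((symmDiff T (Uset g)).erase (2 * g + 2)).filter fun k => i < k / 2).card : ℤ) -
      (tailExcess g T (i + 1) + if 2 * i + 2 ∈ T then 1 else 0) := by
  have h : (((symmDiff T (Uset g)).erase (2 * g + 2)).filter fun k => i < k / 2) =
      (Finset.Icc (2 * i + 2) (2 * g + 1)).filter fun k => (k ∈ T ↔ k % 2 = 0) := by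
    ext k
    rw [Finset.mem_filter, mem_symmDiff_Uset_erase hT, Finset.mem_filter, Finset.mem_Icc,
      Finset.mem_Icc]
    constructor
    · rintro ⟨⟨h1, h2⟩, h3⟩
      exact ⟨by omega, h2⟩
    · rintro ⟨h1, h2⟩
      exact ⟨⟨by omega, h2⟩, by omega⟩
  have h' : tailExcess g T (i + 1) + (if 2 * i + 2 ∈ T then 1 else 0) =
      ∑ k ∈ Finset.Icc (2 * i + 2) (2 * g + 1),
        ((if k ∈ T then 1 else 0) - ((k % 2 : ℕ) : ℤ)) := by
    rw [sum_Icc_even_start hi, tailExcess, show (2 * i + 2) % 2 = 0 by omega]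
    push_cast
    ring
  rw [h, h', Finset.card_filter, Nat.cast_sum, ← Finset.sum_sub_distrib]
  refine Finset.dvd_sum fun k _ => ?_
  rcases Nat.mod_two_eq_zero_or_one k with hk | hk <;> by_cases hkT : k ∈ T <;> simp [hk, hkT]

lemma etaSet_mul_eq_tailExcess {g : ℕ} {T : Finset ℕ} (hT : T ⊆ Finset.Icc 1 (2 * g + 1))
    (i : Fin g) :
    ∃ m : ℤ, 8 * ((etaSet g (symmDiff T (Uset g))).1 i * (etaSet g (symmDiff T (Uset g))).2 i) =
      ((tailExcess g T i * (tailExcess g T i + 1)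
        - tailExcess g T (i + 1) * (tailExcess g T (i + 1) + 1) + 4 * m : ℤ) : ℝ) := by
  rw [etaSet_fst, etaSet_snd, card_filter_fst i.2 hT]
  have hpar := card_filter_snd i.2 hT
  rw [tailExcess_succ i.2]
  generalize (Finset.card _) = n at hpar ⊢
  generalize tailExcess g T (i + 1) = A at hpar ⊢
  suffices h : ∃ m : ℤ, 2 * (((((if 2 * (i : ℕ) + 1 ∈ T then 0 else 1) +
      (if 2 * (i : ℕ) + 2 ∈ T then 1 else 0)) % 2 : ℕ) : ℤ) * ((n % 2 : ℕ) : ℤ)) =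
      (A + (if 2 * (i : ℕ) + 1 ∈ T then 1 else 0) + (if 2 * (i : ℕ) + 2 ∈ T then 1 else 0) - 1) *
        (A + (if 2 * (i : ℕ) + 1 ∈ T then 1 else 0) + (if 2 * (i : ℕ) + 2 ∈ T then 1 else 0)
          - 1 + 1) - A * (A + 1) + 4 * m by
    obtain ⟨m, hm⟩ := h
    refine ⟨m, ?_⟩
    rw [← hm, Int.cast_mul, Int.cast_mul, Int.cast_natCast, Int.cast_natCast, Int.cast_ofNat]
    ring
  by_cases h1 : 2 * (i : ℕ) + 1 ∈ T <;> by_cases h2 : 2 * (i : ℕ) + 2 ∈ T <;>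
    simp only [h1, h2, if_true, if_false] at hpar ⊢
  · refine ⟨(2 * ((n % 2 : ℕ) : ℤ) - 2 * (A + 1)) / 4, ?_⟩
    ring_nf
    omega
  · exact ⟨0, by norm_num⟩
  · exact ⟨0, by norm_num⟩
  · refine ⟨(2 * ((n % 2 : ℕ) : ℤ) + 2 * A) / 4, ?_⟩
    ring_nf
    omega

/-- For every subset `T` of `{1,…,2g+1}` of cardinality `g+1`, the analytic
theta characteristic `η_{T ∘ U}` is even. -/
theorem etaSet_symmDiff_even (g : ℕ) (hg : 2 ≤ g) (T : Finset ℕ)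
    (hT : T ⊆ Finset.Icc 1 (2 * g + 1)) (hcard : T.card = g + 1) :
    IsEvenChar (etaSet g (symmDiff T (Uset g))) := by
  choose m hm using etaSet_mul_eq_tailExcess hT
  refine ⟨∑ i, m i, ?_⟩
  have hg_end : tailExcess g T g * (tailExcess g T g + 1) = 0 := by
    rw [tailExcess_self]
    split_ifs <;> norm_num
  have htel : ∑ i : Fin g, (tailExcess g T i * (tailExcess g T i + 1)
      - tailExcess g T (i + 1) * (tailExcess g T (i + 1) + 1)) = 0 := by
    rw [Fin.sum_univ_eq_sum_range (fun i => tailExcess g T i * (tailExcess g T i + 1)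
      - tailExcess g T (i + 1) * (tailExcess g T (i + 1) + 1)), Finset.sum_range_sub',
      hg_end, tailExcess_zero hT hcard]
    norm_num
  have hsum := Finset.sum_congr rfl fun i (_ : i ∈ Finset.univ) => hm i
  rw [← Finset.mul_sum, ← Int.cast_sum, Finset.sum_add_distrib, htel, ← Finset.mul_sum] at hsum
  push_cast at hsum ⊢
  linarith

end
end

section
/- Let g ≥ 2 and r := binom(2g+1, g+1). For every γ ∈ Sp(2g, ℤ) with γ ≡ I_{2g} mod 2, written in g×g blocks as γ = (A B; C D), and every τ in the Siegel upper half-space H_g, the matrix Cτ + D is invertible, γ·τ := (Aτ + B)(Cτ + D)^{−1} lies in H_g, and the modular discriminant satisfies φ_g(γ·τ) = det(Cτ + D)^{4r} · φ_g(τ). -/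
open scoped Classical BigOperators

noncomputable section

/-- The modular discriminant `φ_g(τ) = ∏_{T ∈ 𝒯} θ[η_{T∘U}](0;τ)^8`, the product
running over the subsets `T` of `{1,…,2g+1}` of cardinality `g+1`. -/
def phi (g : ℕ) (τ : Matrix (Fin g) (Fin g) ℂ) : ℂ :=
  ∏ T ∈ (Finset.Icc 1 (2 * g + 1)).powersetCard (g + 1),
    theta (etaSet g (symmDiff T (Uset g))) 0 τ ^ 8

/-- The symplectic condition on the four `g×g` blocks `(A B; C D)` of a matrix
in `Sp(2g, ℤ)`: `ᵗM J M = J` for `J = (0 1; -1 0)`. -/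
def SpBlocks (g : ℕ) (A B C D : Matrix (Fin g) (Fin g) ℤ) : Prop :=
  Matrix.transpose (Matrix.fromBlocks A B C D) *
      Matrix.fromBlocks (0 : Matrix (Fin g) (Fin g) ℤ) 1 (-1) 0 *
      Matrix.fromBlocks A B C D =
    Matrix.fromBlocks (0 : Matrix (Fin g) (Fin g) ℤ) 1 (-1) 0

/-- `γ = (A B; C D) ≡ I_{2g} mod 2`. -/
def CongImod2 (g : ℕ) (A B C D : Matrix (Fin g) (Fin g) ℤ) : Prop :=
  ∀ p q, (2 : ℤ) ∣
    (Matrix.fromBlocks A B C D p q -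
      (1 : Matrix (Fin g ⊕ Fin g) (Fin g ⊕ Fin g) ℤ) p q)


/-! ### Generation of the integral symplectic group -/

namespace SymplecticReduction

open Matrix

theorem exists_eq_zero_of_moves {X : Type*} (Inv : X → Prop) (p q : X → ℤ)
    (hp : ∀ x t, Inv x → ∃ y, Inv y ∧ p y = p x + t * q x ∧ q y = q x)
    (hq : ∀ x t, Inv x → ∃ y, Inv y ∧ q y = q x + t * p x ∧ p y = p x)
    (x : X) (hx : Inv x) : ∃ y, Inv y ∧ q y = 0 := by
  induction h : (q x).natAbs using Nat.strong_induction_on generalizing x with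
  | _ N ih =>
    by_cases hqx : q x = 0
    · exact ⟨x, hx, hqx⟩
    obtain ⟨y, hy, hpy, hqy⟩ := hp x (-(p x / q x)) hx
    have hmod : p y = p x % q x := by rw [hpy, Int.emod_def]; ring
    by_cases h0 : p y = 0
    · obtain ⟨z, hz, hpz, hqz⟩ := hp y 1 hy
      obtain ⟨w, hw, hqw, -⟩ := hq z (-1) hz
      exact ⟨w, hw, by rw [hqw, hpz, hqz, h0]; ring⟩
    obtain ⟨z, hz, hqz, -⟩ := hq y (-(q y / p y)) hy
    have hmod' : q z = q x % p y := by rw [hqz, Int.emod_def, hqy]; ring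
    refine ih _ ?_ z hz rfl
    have h1 := Int.emod_lt_abs (p x) hqx
    have h2 := Int.emod_nonneg (p x) hqx
    have h3 := Int.emod_lt_abs (q x) h0
    have h4 := Int.emod_nonneg (q x) h0
    rw [← hmod] at h1 h2
    rw [← hmod'] at h3 h4
    rw [abs_of_nonneg h2] at h3
    rw [← h]
    zify
    rw [abs_of_nonneg h4]
    exact h3.trans h1

variable {g : ℕ}

/-- The first `k` columns of the left half of `M` are upper triangular, with vanishing lower
block. -/
def Reduced (k : ℕ) (M : Matrix (Fin g ⊕ Fin g) (Fin g ⊕ Fin g) ℤ) : Prop :=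
  ∀ j : Fin g, (j : ℕ) < k →
    (∀ i, j < i → M (.inl i) (.inl j) = 0) ∧ ∀ i, M (.inr i) (.inl j) = 0

theorem blocks_of_mem {M : Matrix (Fin g ⊕ Fin g) (Fin g ⊕ Fin g) ℤ}
    (hM : M ∈ symplecticGroup (Fin g) ℤ) :
    M.toBlocks₁₁ᵀ * M.toBlocks₂₁ = M.toBlocks₂₁ᵀ * M.toBlocks₁₁ ∧
      M.toBlocks₁₂ᵀ * M.toBlocks₂₂ = M.toBlocks₂₂ᵀ * M.toBlocks₁₂ ∧
      M.toBlocks₁₁ᵀ * M.toBlocks₂₂ - M.toBlocks₂₁ᵀ * M.toBlocks₁₂ = 1 := by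
  rw [← fromBlocks_toBlocks M] at hM
  exact SymplecticGroup.fromBlocks_mem_iff.1 hM

theorem Reduced.diag_ne_zero {k : ℕ} {M : Matrix (Fin g ⊕ Fin g) (Fin g ⊕ Fin g) ℤ}
    (hM : M ∈ symplecticGroup (Fin g) ℤ) (h : Reduced k M) (j : Fin g) (hj : (j : ℕ) < k) :
    M (.inl j) (.inl j) ≠ 0 := by
  induction j using WellFoundedLT.induction with
  | _ j ih =>
    have key : ∀ p i : Fin g, (p : ℕ) < k →
        ∑ l, M (.inl l) (.inl p) * M (.inr l) (.inr i) = if p = i then 1 else 0 := by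
      intro p i hp
      have := congrFun (congrFun (blocks_of_mem hM).2.2 p) i
      simpa [mul_apply, toBlocks₁₁, toBlocks₂₁, toBlocks₂₂, toBlocks₁₂, (h p hp).2,
        Matrix.one_apply] using this
    have hD : ∀ p : Fin g, p < j → M (.inr p) (.inr j) = 0 := by
      intro p
      induction p using WellFoundedLT.induction with
      | _ p ihp =>
        intro hpj
        have hpk : (p : ℕ) < k := lt_trans hpj hj
        have h1 := key p j hpk
        rw [Finset.sum_eq_single p, if_neg hpj.ne] at h1
        · exact (mul_eq_zero.1 h1).resolve_left (ih p hpj hpk)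
        · intro l _ hl
          rcases lt_or_gt_of_ne hl with hl | hl
          · rw [ihp l hl (hl.trans hpj), mul_zero]
          · rw [(h p hpk).1 l hl, zero_mul]
        · simp
    have h1 := key j j hj
    rw [Finset.sum_eq_single j, if_pos rfl] at h1
    · intro h0
      simp [h0] at h1
    · intro l _ hl
      rcases lt_or_gt_of_ne hl with hl | hl
      · rw [hD l hl, mul_zero]
      · rw [(h j hj).1 l hl, zero_mul]
    · simp

theorem Reduced.lower_row_eq_zero {k : ℕ} {M : Matrix (Fin g ⊕ Fin g) (Fin g ⊕ Fin g) ℤ}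
    (hM : M ∈ symplecticGroup (Fin g) ℤ) (h : Reduced k M) (j : Fin g) (hj : (j : ℕ) < k)
    (m : Fin g) : M (.inr j) (.inl m) = 0 := by
  induction j using WellFoundedLT.induction with
  | _ j ih =>
    have h1 := congrFun (congrFun (blocks_of_mem hM).1 j) m
    simp only [mul_apply, toBlocks₁₁, toBlocks₂₁, transpose_apply, of_apply, (h j hj).2,
      zero_mul, Finset.sum_const_zero] at h1
    rw [Finset.sum_eq_single j] at h1
    · exact (mul_eq_zero.1 h1).resolve_left (h.diag_ne_zero hM j hj)
    · intro l _ hl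
      rcases lt_or_gt_of_ne hl with hl | hl
      · rw [ih l hl (lt_trans (Fin.lt_def.1 hl) hj), mul_zero]
      · rw [(h j hj).1 l hl, zero_mul]
    · simp

/-- The upper unipotent matrix attached to `S`. -/
def upper (S : Matrix (Fin g) (Fin g) ℤ) : Matrix (Fin g ⊕ Fin g) (Fin g ⊕ Fin g) ℤ :=
  fromBlocks 1 S 0 1

/-- The lower unipotent matrix attached to `S`. -/
def lower (S : Matrix (Fin g) (Fin g) ℤ) : Matrix (Fin g ⊕ Fin g) (Fin g ⊕ Fin g) ℤ :=
  fromBlocks 1 0 S 1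

/-- The block diagonal matrix with blocks `U` and `ᵗV`; it is symplectic if `U * V = 1`. -/
def levi (U V : Matrix (Fin g) (Fin g) ℤ) : Matrix (Fin g ⊕ Fin g) (Fin g ⊕ Fin g) ℤ :=
  fromBlocks U 0 0 Vᵀ

/-- The partial inversion in the `i`-th coordinate. -/
def inversion (i : Fin g) : Matrix (Fin g ⊕ Fin g) (Fin g ⊕ Fin g) ℤ :=
  fromBlocks (1 - single i i 1) (-single i i 1) (single i i 1) (1 - single i i 1)

theorem upper_mem {S : Matrix (Fin g) (Fin g) ℤ} (hS : S.IsSymm) :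
    upper S ∈ symplecticGroup (Fin g) ℤ :=
  SymplecticGroup.fromBlocks_mem_iff.2 (by simp [hS.eq])

theorem lower_mem {S : Matrix (Fin g) (Fin g) ℤ} (hS : S.IsSymm) :
    lower S ∈ symplecticGroup (Fin g) ℤ :=
  SymplecticGroup.fromBlocks_mem_iff.2 (by simp [hS.eq])

theorem levi_mem {U V : Matrix (Fin g) (Fin g) ℤ} (h : U * V = 1) :
    levi U V ∈ symplecticGroup (Fin g) ℤ :=
  SymplecticGroup.fromBlocks_mem_iff.2 (by
    simp [← transpose_mul, mul_eq_one_comm.1 h])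

theorem inversion_mem (i : Fin g) : inversion i ∈ symplecticGroup (Fin g) ℤ :=
  SymplecticGroup.fromBlocks_mem_iff.2 (by
    simp only [transpose_sub, transpose_one, transpose_single, transpose_neg]
    have h : (single i i 1 : Matrix (Fin g) (Fin g) ℤ) * single i i 1 = single i i 1 := by simp
    refine ⟨?_, ?_, ?_⟩ <;> noncomm_ring [h])

theorem lower_single_eq (i : Fin g) (t : ℤ) :
    lower (single i i t) =
      inversion i * (upper (single i i (-t)) * (inversion i * (inversion i * inversion i))) := by
  have h1 : (single i i 1 : Matrix (Fin g) (Fin g) ℤ) * single i i 1 = single i i 1 := by simp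
  have h2 (t : ℤ) : (single i i t : Matrix (Fin g) (Fin g) ℤ) = t • single i i 1 := by simp
  rw [h2 t, h2 (-t)]
  simp only [lower, inversion, upper, fromBlocks_multiply, fromBlocks_inj]
  generalize (single i i 1 : Matrix (Fin g) (Fin g) ℤ) = E at h1
  refine ⟨?_, ?_, ?_, ?_⟩ <;> noncomm_ring [h1]
  simp

theorem upper_single_mul_inl (i : Fin g) (t : ℤ)
    (M : Matrix (Fin g ⊕ Fin g) (Fin g ⊕ Fin g) ℤ) (a : Fin g) (j : Fin g ⊕ Fin g) :
    (upper (single i i t) * M) (.inl a) j =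
      M (.inl a) j + if a = i then t * M (.inr i) j else 0 := by
  simp [upper, mul_apply, Fintype.sum_sum_type, single_apply, Matrix.one_apply, ite_and,
    eq_comm]

theorem upper_single_mul_inr (i : Fin g) (t : ℤ)
    (M : Matrix (Fin g ⊕ Fin g) (Fin g ⊕ Fin g) ℤ) (a : Fin g) (j : Fin g ⊕ Fin g) :
    (upper (single i i t) * M) (.inr a) j = M (.inr a) j := by
  simp [upper, mul_apply, Fintype.sum_sum_type, Matrix.one_apply]

theorem lower_single_mul_inl (i : Fin g) (t : ℤ)
    (M : Matrix (Fin g ⊕ Fin g) (Fin g ⊕ Fin g) ℤ) (a : Fin g) (j : Fin g ⊕ Fin g) :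
    (lower (single i i t) * M) (.inl a) j = M (.inl a) j := by
  simp [lower, mul_apply, Fintype.sum_sum_type, Matrix.one_apply]

theorem lower_single_mul_inr (i : Fin g) (t : ℤ)
    (M : Matrix (Fin g ⊕ Fin g) (Fin g ⊕ Fin g) ℤ) (a : Fin g) (j : Fin g ⊕ Fin g) :
    (lower (single i i t) * M) (.inr a) j =
      M (.inr a) j + if a = i then t * M (.inl i) j else 0 := by
  simp [lower, mul_apply, Fintype.sum_sum_type, single_apply, Matrix.one_apply, ite_and,
    eq_comm, add_comm]

/-- The block diagonal matrix adding `t` times row `b` to row `a` in the upper half. -/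
def leviTransvection (a b : Fin g) (t : ℤ) : Matrix (Fin g ⊕ Fin g) (Fin g ⊕ Fin g) ℤ :=
  levi (transvection a b t) (transvection a b (-t))

theorem leviTransvection_mul_inl (a b : Fin g) (t : ℤ)
    (M : Matrix (Fin g ⊕ Fin g) (Fin g ⊕ Fin g) ℤ) (i : Fin g) (j : Fin g ⊕ Fin g) :
    (leviTransvection a b t * M) (.inl i) j =
      M (.inl i) j + if i = a then t * M (.inl b) j else 0 := by
  simp [leviTransvection, levi, transvection, mul_apply, Fintype.sum_sum_type, single_apply,
    Matrix.one_apply, ite_and, add_mul, Finset.sum_add_distrib, eq_comm]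

theorem leviTransvection_mul_inr (a b : Fin g) (t : ℤ)
    (M : Matrix (Fin g ⊕ Fin g) (Fin g ⊕ Fin g) ℤ) (i : Fin g) (j : Fin g ⊕ Fin g) :
    (leviTransvection a b t * M) (.inr i) j =
      M (.inr i) j - if i = b then t * M (.inr a) j else 0 := by
  simp [leviTransvection, levi, transvection, mul_apply, Fintype.sum_sum_type, single_apply,
    Matrix.one_apply, ite_and, add_mul, Finset.sum_add_distrib, eq_comm]
  split_ifs <;> ring

variable {Q : Matrix (Fin g ⊕ Fin g) (Fin g ⊕ Fin g) ℤ → Prop}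

theorem exists_lower_column_eq_zero
    (hQ : ∀ M, Q M → M ∈ symplecticGroup (Fin g) ℤ)
    (hT : ∀ M i t, Q M → Q (upper (single i i t) * M))
    (hL : ∀ M i t, Q M → Q (lower (single i i t) * M))
    (k : Fin g) (M : Matrix (Fin g ⊕ Fin g) (Fin g ⊕ Fin g) ℤ) (hM : Q M) (hk : Reduced k M) :
    ∃ N, Q N ∧ Reduced k N ∧ ∀ i, N (.inr i) (.inl k) = 0 := by
  suffices H : ∀ s : Finset (Fin g),
      ∃ N, Q N ∧ Reduced k N ∧ ∀ i ∈ s, N (.inr i) (.inl k) = 0 by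
    obtain ⟨N, h1, h2, h3⟩ := H Finset.univ
    exact ⟨N, h1, h2, fun i => h3 i (Finset.mem_univ i)⟩
  intro s
  induction s using Finset.induction_on with
  | empty => exact ⟨M, hM, hk, by simp⟩
  | insert i s hi ih =>
    obtain ⟨N, hN, hr, h0⟩ := ih
    rcases lt_or_ge i k with hik | hik
    · exact ⟨N, hN, hr, by
        simpa [hr.lower_row_eq_zero (hQ N hN) i hik] using h0⟩
    obtain ⟨N', ⟨h1, h2, h3⟩, h4⟩ := exists_eq_zero_of_moves
      (fun N => Q N ∧ Reduced k N ∧ ∀ i ∈ s, N (.inr i) (.inl k) = 0)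
      (fun N => N (.inl i) (.inl k)) (fun N => N (.inr i) (.inl k))
      (fun x t hx => ⟨_, ⟨hT x i t hx.1, fun j hj => ⟨fun a ha => by
          rw [upper_single_mul_inl, (hx.2.1 j hj).1 a ha, (hx.2.1 j hj).2]; simp,
          fun a => by rw [upper_single_mul_inr, (hx.2.1 j hj).2]⟩,
          fun a ha => by rw [upper_single_mul_inr, hx.2.2 a ha]⟩,
          by simp [upper_single_mul_inl], by simp [upper_single_mul_inr]⟩)
      (fun x t hx => ⟨_, ⟨hL x i t hx.1, fun j hj => ⟨fun a ha => by
          rw [lower_single_mul_inl, (hx.2.1 j hj).1 a ha],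
          fun a => by
            rw [lower_single_mul_inr, (hx.2.1 j hj).2,
              (hx.2.1 j hj).1 i (lt_of_lt_of_le hj hik)]; simp⟩,
          fun a ha => by
            rw [lower_single_mul_inr, hx.2.2 a ha, if_neg (ne_of_mem_of_not_mem ha hi)]; simp⟩,
          by simp [lower_single_mul_inr], by simp [lower_single_mul_inl]⟩)
      N ⟨hN, hr, h0⟩
    exact ⟨N', h1, h2, by simpa [h4] using h3⟩

theorem exists_reduced_succ
    (hQ : ∀ M, Q M → M ∈ symplecticGroup (Fin g) ℤ)
    (hT : ∀ M i t, Q M → Q (upper (single i i t) * M))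
    (hL : ∀ M i t, Q M → Q (lower (single i i t) * M))
    (hU : ∀ M a b t, a ≠ b → Q M → Q (leviTransvection a b t * M))
    (k : Fin g) (M : Matrix (Fin g ⊕ Fin g) (Fin g ⊕ Fin g) ℤ) (hM : Q M) (hk : Reduced k M) :
    ∃ N, Q N ∧ Reduced (k + 1) N := by
  suffices H : ∀ s : Finset (Fin g),
      ∃ N, Q N ∧ Reduced k N ∧ (∀ i, N (.inr i) (.inl k) = 0) ∧
        ∀ i ∈ s, k < i → N (.inl i) (.inl k) = 0 by
    obtain ⟨N, h1, h2, h3, h4⟩ := H Finset.univ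
    refine ⟨N, h1, fun j hj => ?_⟩
    rcases Nat.lt_succ_iff_lt_or_eq.1 hj with hj | hj
    · exact h2 j hj
    · obtain rfl := Fin.ext hj
      exact ⟨fun i => h4 i (Finset.mem_univ i), h3⟩
  intro s
  induction s using Finset.induction_on with
  | empty =>
    obtain ⟨N, h⟩ := exists_lower_column_eq_zero hQ hT hL k M hM hk
    exact ⟨N, h.1, h.2.1, h.2.2, by simp⟩
  | insert i s hi ih =>
    obtain ⟨N, hN, hr, hc, h0⟩ := ih
    rcases le_or_gt i k with hik | hik
    · exact ⟨N, hN, hr, hc, by simpa [hik] using h0⟩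
    obtain ⟨N', ⟨h1, h2, h3, h4⟩, h5⟩ := exists_eq_zero_of_moves
      (fun N => Q N ∧ Reduced k N ∧ (∀ i, N (.inr i) (.inl k) = 0) ∧
        ∀ i ∈ s, k < i → N (.inl i) (.inl k) = 0)
      (fun N => N (.inl k) (.inl k)) (fun N => N (.inl i) (.inl k))
      (fun x t hx => ⟨_, ⟨hU x k i t hik.ne hx.1, fun j hj => ⟨fun a ha => by
          rw [leviTransvection_mul_inl, (hx.2.1 j hj).1 a ha,
            (hx.2.1 j hj).1 i (lt_trans (Fin.lt_def.2 hj) hik)]; simp,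
          fun a => by rw [leviTransvection_mul_inr, (hx.2.1 j hj).2, (hx.2.1 j hj).2]; simp⟩,
          fun a => by rw [leviTransvection_mul_inr, hx.2.2.1, hx.2.2.1]; simp,
          fun a ha hka => by
            rw [leviTransvection_mul_inl, hx.2.2.2 a ha hka, if_neg hka.ne']; simp⟩,
          by simp [leviTransvection_mul_inl], by simp [leviTransvection_mul_inl, hik.ne']⟩)
      (fun x t hx => ⟨_, ⟨hU x i k t hik.ne' hx.1, fun j hj => ⟨fun a ha => by
          rw [leviTransvection_mul_inl, (hx.2.1 j hj).1 a ha,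
            (hx.2.1 j hj).1 k (Fin.lt_def.2 hj)]; simp,
          fun a => by rw [leviTransvection_mul_inr, (hx.2.1 j hj).2, (hx.2.1 j hj).2]; simp⟩,
          fun a => by rw [leviTransvection_mul_inr, hx.2.2.1, hx.2.2.1]; simp,
          fun a ha hka => by
            rw [leviTransvection_mul_inl, hx.2.2.2 a ha hka,
              if_neg (ne_of_mem_of_not_mem ha hi)]; simp⟩,
          by simp [leviTransvection_mul_inl], by simp [leviTransvection_mul_inl, hik.ne]⟩)
      N ⟨hN, hr, hc, h0⟩
    refine ⟨N', h1, h2, h3, fun a ha hka => ?_⟩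
    rcases Finset.mem_insert.1 ha with rfl | ha
    · exact h5
    · exact h4 a ha hka

theorem exists_lower_block_eq_zero
    (hQ : ∀ M, Q M → M ∈ symplecticGroup (Fin g) ℤ)
    (hT : ∀ M i t, Q M → Q (upper (single i i t) * M))
    (hL : ∀ M i t, Q M → Q (lower (single i i t) * M))
    (hU : ∀ M a b t, a ≠ b → Q M → Q (leviTransvection a b t * M))
    (M : Matrix (Fin g ⊕ Fin g) (Fin g ⊕ Fin g) ℤ) (hM : Q M) :
    ∃ N, Q N ∧ N.toBlocks₂₁ = 0 := by
  have H : ∀ k ≤ g, ∃ N, Q N ∧ Reduced k N := by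
    intro k
    induction k with
    | zero => exact fun _ => ⟨M, hM, fun j hj => absurd hj (Nat.not_lt_zero _)⟩
    | succ k ih =>
      intro hk
      obtain ⟨N, hN, hr⟩ := ih (by omega)
      exact exists_reduced_succ hQ hT hL hU ⟨k, hk⟩ N hN hr
  obtain ⟨N, hN, hr⟩ := H g le_rfl
  exact ⟨N, hN, by ext i j; exact (hr j j.2).2 i⟩

/-- A property of integral symplectic matrices that is stable under products holds for all of them
once it holds for the unipotent, block diagonal and partial inversion matrices. -/
theorem symplectic_induction {P : Matrix (Fin g ⊕ Fin g) (Fin g ⊕ Fin g) ℤ → Prop}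
    (mul : ∀ M N, M ∈ symplecticGroup (Fin g) ℤ → N ∈ symplecticGroup (Fin g) ℤ →
      P M → P N → P (M * N))
    (hupper : ∀ S : Matrix (Fin g) (Fin g) ℤ, S.IsSymm → P (upper S))
    (hlevi : ∀ U V : Matrix (Fin g) (Fin g) ℤ, U * V = 1 → P (levi U V))
    (hinv : ∀ i, P (inversion i))
    (M : Matrix (Fin g ⊕ Fin g) (Fin g ⊕ Fin g) ℤ) (hM : M ∈ symplecticGroup (Fin g) ℤ) :
    P M := by
  have hsymm (i : Fin g) (t : ℤ) : (single i i t : Matrix (Fin g) (Fin g) ℤ).IsSymm := by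
    simp [IsSymm]
  have hlower (i : Fin g) (t : ℤ) : P (lower (single i i t)) := by
    have hi := inversion_mem i
    have hi2 := mul_mem hi hi
    have hi3 := mul_mem hi hi2
    have ht := upper_mem (hsymm i (-t))
    rw [lower_single_eq]
    exact mul _ _ hi (mul_mem ht hi3) (hinv i) (mul _ _ ht hi3 (hupper _ (hsymm i _))
      (mul _ _ hi hi2 (hinv i) (mul _ _ hi hi (hinv i) (hinv i))))
  have cancel (X Y N) (hX : X ∈ symplecticGroup (Fin g) ℤ) (hY : Y ∈ symplecticGroup (Fin g) ℤ)
      (hYX : Y * X = 1) (hP : P Y)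
      (hN : N ∈ symplecticGroup (Fin g) ℤ ∧ (P N → P M)) :
      X * N ∈ symplecticGroup (Fin g) ℤ ∧ (P (X * N) → P M) := by
    refine ⟨mul_mem hX hN.1, fun h => hN.2 ?_⟩
    have := mul _ _ hY (mul_mem hX hN.1) hP h
    rwa [← Matrix.mul_assoc, hYX, Matrix.one_mul] at this
  obtain ⟨N, ⟨hN, hNM⟩, h0⟩ := exists_lower_block_eq_zero
    (Q := fun N => N ∈ symplecticGroup (Fin g) ℤ ∧ (P N → P M)) (fun _ h => h.1)
    (fun N i t => cancel _ (upper (single i i (-t))) N (upper_mem (hsymm i t))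
      (upper_mem (hsymm i (-t)))
      (by simp [upper, fromBlocks_multiply, ← single_add]) (hupper _ (hsymm i _)))
    (fun N i t => cancel _ (lower (single i i (-t))) N (lower_mem (hsymm i t))
      (lower_mem (hsymm i (-t)))
      (by simp [lower, fromBlocks_multiply, ← single_add]) (hlower i _))
    (fun N a b t hab => cancel _ (leviTransvection a b (-t)) N
      (levi_mem (by simp [transvection_mul_transvection_same, hab]))
      (levi_mem (by simp [transvection_mul_transvection_same, hab]))
      (by simp [leviTransvection, levi, fromBlocks_multiply, ← transpose_mul,
        transvection_mul_transvection_same, hab])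
      (hlevi _ _ (by simp [transvection_mul_transvection_same, hab])))
    M ⟨hM, id⟩
  obtain ⟨-, h2, h3⟩ := blocks_of_mem hN
  rw [h0, transpose_zero, Matrix.zero_mul, sub_zero] at h3
  refine hNM ?_
  have hDA : N.toBlocks₂₂ * N.toBlocks₁₁ᵀ = 1 := mul_eq_one_comm.1 h3
  have hAD : N.toBlocks₁₁ * N.toBlocks₂₂ᵀ = 1 := by
    rw [← transpose_inj, transpose_mul, transpose_transpose, hDA, transpose_one]
  have hDA' : N.toBlocks₂₂ᵀ * N.toBlocks₁₁ = 1 := mul_eq_one_comm.1 hAD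
  have hS : (N.toBlocks₁₂ * N.toBlocks₁₁ᵀ).IsSymm := by
    have : N.toBlocks₁₁ * (N.toBlocks₁₂ᵀ * N.toBlocks₂₂) * N.toBlocks₁₁ᵀ =
        N.toBlocks₁₁ * (N.toBlocks₂₂ᵀ * N.toBlocks₁₂) * N.toBlocks₁₁ᵀ := by rw [h2]
    rw [← Matrix.mul_assoc, ← Matrix.mul_assoc, hAD, Matrix.one_mul,
      Matrix.mul_assoc _ _ N.toBlocks₁₁ᵀ, hDA, Matrix.mul_one] at this
    rw [IsSymm, transpose_mul, transpose_transpose, this]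
  have hfac : N = upper (N.toBlocks₁₂ * N.toBlocks₁₁ᵀ) *
      levi N.toBlocks₁₁ N.toBlocks₂₂ᵀ := by
    conv_lhs => rw [← fromBlocks_toBlocks N, h0]
    simp [upper, levi, fromBlocks_multiply, Matrix.mul_assoc, h3]
  rw [hfac]
  exact mul _ _ (upper_mem hS) (levi_mem hAD) (hupper _ hS) (hlevi _ _ hAD)

end SymplecticReduction
/-! ### The action on the Siegel upper half-space -/

namespace SiegelAction

open Matrix Complex
open scoped ComplexOrder

variable {g : ℕ}

theorem posDef_map_ofReal_iff {Y : Matrix (Fin g) (Fin g) ℝ} :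
    (Y.map ((↑) : ℝ → ℂ)).PosDef ↔ Y.PosDef := by
  rw [posDef_iff_dotProduct_mulVec, posDef_iff_dotProduct_mulVec]
  constructor
  · rintro ⟨h, hpos⟩
    refine ⟨?_, fun x hx => ?_⟩
    · ext i j
      have := congrFun (congrFun h.eq i) j
      simpa using this
    · have hx' : (fun i => (x i : ℂ)) ≠ 0 := by
        contrapose! hx
        ext i
        simpa using congrFun hx i
      have := hpos hx'
      simp only [dotProduct, mulVec, Pi.star_apply, map_apply, RCLike.star_def, conj_ofReal] at this
      simp only [dotProduct, mulVec, Pi.star_apply, star_trivial]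
      exact_mod_cast this
  · rintro ⟨h, hpos⟩
    have hsymm : ∀ i j, Y j i = Y i j := fun i j => by
      simpa using congrFun (congrFun h.eq i) j
    refine ⟨?_, fun x hx => ?_⟩
    · ext i j
      simp [hsymm]
    · have hsplit : star x ⬝ᵥ (Y.map ((↑) : ℝ → ℂ) *ᵥ x) =
          ((((fun i => (x i).re) ⬝ᵥ (Y *ᵥ fun i => (x i).re)) +
            ((fun i => (x i).im) ⬝ᵥ (Y *ᵥ fun i => (x i).im)) : ℝ) : ℂ) := by
        simp only [dotProduct, mulVec, Pi.star_apply, map_apply, RCLike.star_def]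
        apply Complex.ext
        · simp only [Finset.mul_sum, re_sum, ofReal_re, ← Finset.sum_add_distrib]
          refine Finset.sum_congr rfl fun i _ => Finset.sum_congr rfl fun j _ => ?_
          simp
        · simp only [Finset.mul_sum, im_sum, ofReal_im]
          have h1 : ∀ i j, ((starRingEnd ℂ) (x i) * ((Y i j : ℂ) * x j)).im =
              (x i).re * Y i j * (x j).im - (x i).im * Y i j * (x j).re := fun i j => by
            simp; ring
          simp only [h1, Finset.sum_sub_distrib, sub_eq_zero]
          rw [Finset.sum_comm]
          refine Finset.sum_congr rfl fun i _ => Finset.sum_congr rfl fun j _ => ?_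
          rw [hsymm i j]; ring
      rw [hsplit]
      have hnn : ∀ u : Fin g → ℝ, 0 ≤ u ⬝ᵥ (Y *ᵥ u) := fun u => by
        by_cases hu : u = 0
        · simp [hu]
        · simpa using (hpos hu).le
      have : 0 < ((fun i => (x i).re) ⬝ᵥ (Y *ᵥ fun i => (x i).re)) +
            ((fun i => (x i).im) ⬝ᵥ (Y *ᵥ fun i => (x i).im)) := by
        by_cases hre : (fun i => (x i).re) = 0
        · have him : (fun i => (x i).im) ≠ 0 := by
            contrapose! hx
            ext i
            exact Complex.ext (congrFun hre i) (congrFun hx i)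
          exact add_pos_of_nonneg_of_pos (hnn _) (by simpa using hpos him)
        · exact add_pos_of_pos_of_nonneg (by simpa using hpos hre) (hnn _)
      exact_mod_cast this

theorem sub_conjTranspose_eq {τ : Matrix (Fin g) (Fin g) ℂ} (hτ : τ.IsSymm) :
    τ - τᴴ = (2 * I) • (τ.map Complex.im).map ((↑) : ℝ → ℂ) := by
  ext i j
  have h : τ j i = τ i j := hτ.apply i j
  apply Complex.ext <;> simp [h]
  ring

/-- The numerator `Aτ + B` of the action of `(A B; C D)` on `τ`. -/
def num (M : Matrix (Fin g ⊕ Fin g) (Fin g ⊕ Fin g) ℤ) (τ : Matrix (Fin g) (Fin g) ℂ) :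
    Matrix (Fin g) (Fin g) ℂ :=
  M.toBlocks₁₁.map (Int.cast : ℤ → ℂ) * τ + M.toBlocks₁₂.map (Int.cast : ℤ → ℂ)

/-- The denominator `Cτ + D` of the action of `(A B; C D)` on `τ`. -/
def denom (M : Matrix (Fin g ⊕ Fin g) (Fin g ⊕ Fin g) ℤ) (τ : Matrix (Fin g) (Fin g) ℂ) :
    Matrix (Fin g) (Fin g) ℂ :=
  M.toBlocks₂₁.map (Int.cast : ℤ → ℂ) * τ + M.toBlocks₂₂.map (Int.cast : ℤ → ℂ)

/-- The action of `(A B; C D)` on `τ`. -/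
def act (M : Matrix (Fin g ⊕ Fin g) (Fin g ⊕ Fin g) ℤ) (τ : Matrix (Fin g) (Fin g) ℂ) :
    Matrix (Fin g) (Fin g) ℂ :=
  num M τ * (denom M τ)⁻¹

theorem blocks_map_of_mem {M : Matrix (Fin g ⊕ Fin g) (Fin g ⊕ Fin g) ℤ}
    (hM : M ∈ symplecticGroup (Fin g) ℤ) :
    let A := M.toBlocks₁₁.map (Int.cast : ℤ → ℂ)
    let B := M.toBlocks₁₂.map (Int.cast : ℤ → ℂ)
    let C := M.toBlocks₂₁.map (Int.cast : ℤ → ℂ)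
    let D := M.toBlocks₂₂.map (Int.cast : ℤ → ℂ)
    Aᵀ * C = Cᵀ * A ∧ Bᵀ * D = Dᵀ * B ∧ Aᵀ * D - Cᵀ * B = 1 := by
  obtain ⟨h1, h2, h3⟩ := SymplecticReduction.blocks_of_mem hM
  have hmul : ∀ X Y : Matrix (Fin g) (Fin g) ℤ, (X.map (Int.cast : ℤ → ℂ))ᵀ *
      Y.map (Int.cast : ℤ → ℂ) = (Xᵀ * Y).map (Int.cast : ℤ → ℂ) := fun X Y => by
    rw [← transpose_map]
    exact (Matrix.map_mul (f := Int.castRingHom ℂ)).symm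
  refine ⟨by rw [hmul, hmul, h1], by rw [hmul, hmul, h2], ?_⟩
  rw [hmul, hmul, ← Matrix.map_sub _ (by simp), h3]
  exact Matrix.map_one _ (by simp) (by simp)

theorem conjTranspose_intCast (X : Matrix (Fin g) (Fin g) ℤ) :
    (X.map (Int.cast : ℤ → ℂ))ᴴ = (X.map (Int.cast : ℤ → ℂ))ᵀ := by
  ext i j
  simp

theorem denom_conjTranspose_mul_num {M : Matrix (Fin g ⊕ Fin g) (Fin g ⊕ Fin g) ℤ}
    (hM : M ∈ symplecticGroup (Fin g) ℤ) (τ : Matrix (Fin g) (Fin g) ℂ) :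
    (denom M τ)ᴴ * num M τ - (num M τ)ᴴ * denom M τ = τ - τᴴ := by
  obtain ⟨h1, h2, h3⟩ := blocks_map_of_mem hM
  have h4 := congrArg transpose h3
  simp only [transpose_sub, transpose_mul, transpose_transpose, transpose_one] at h4
  simp only [denom, num, conjTranspose_add, conjTranspose_mul, conjTranspose_intCast]
  generalize M.toBlocks₁₁.map (Int.cast : ℤ → ℂ) = A at *
  generalize M.toBlocks₁₂.map (Int.cast : ℤ → ℂ) = B at *
  generalize M.toBlocks₂₁.map (Int.cast : ℤ → ℂ) = C at *
  generalize M.toBlocks₂₂.map (Int.cast : ℤ → ℂ) = D at *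
  calc _ = τᴴ * (Cᵀ * A - Aᵀ * C) * τ - τᴴ * (Aᵀ * D - Cᵀ * B) +
        (Dᵀ * A - Bᵀ * C) * τ + (Dᵀ * B - Bᵀ * D) := by noncomm_ring
    _ = _ := by rw [h1, h2, h3, h4]; noncomm_ring

theorem num_transpose_mul_denom {M : Matrix (Fin g ⊕ Fin g) (Fin g ⊕ Fin g) ℤ}
    (hM : M ∈ symplecticGroup (Fin g) ℤ) {τ : Matrix (Fin g) (Fin g) ℂ} (hτ : τ.IsSymm) :
    (num M τ)ᵀ * denom M τ = (denom M τ)ᵀ * num M τ := by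
  obtain ⟨h1, h2, h3⟩ := blocks_map_of_mem hM
  have h4 := congrArg transpose h3
  simp only [transpose_sub, transpose_mul, transpose_transpose, transpose_one] at h4
  simp only [denom, num, transpose_add, transpose_mul, hτ.eq]
  generalize M.toBlocks₁₁.map (Int.cast : ℤ → ℂ) = A at *
  generalize M.toBlocks₁₂.map (Int.cast : ℤ → ℂ) = B at *
  generalize M.toBlocks₂₁.map (Int.cast : ℤ → ℂ) = C at *
  generalize M.toBlocks₂₂.map (Int.cast : ℤ → ℂ) = D at *
  rw [← sub_eq_zero]
  calc _ = τ * (Aᵀ * C - Cᵀ * A) * τ + τ * (Aᵀ * D - Cᵀ * B) -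
        (Dᵀ * A - Bᵀ * C) * τ + (Bᵀ * D - Dᵀ * B) := by noncomm_ring
    _ = _ := by rw [h1, h2, h3, h4]; noncomm_ring

theorem isUnit_denom {M : Matrix (Fin g ⊕ Fin g) (Fin g ⊕ Fin g) ℤ}
    (hM : M ∈ symplecticGroup (Fin g) ℤ) {τ : Matrix (Fin g) (Fin g) ℂ} (hτ : IsSiegel τ) :
    IsUnit (denom M τ) := by
  rw [← mulVec_injective_iff_isUnit]
  refine (injective_iff_map_eq_zero (denom M τ).mulVecLin).2 fun x hx => ?_
  rw [mulVecLin_apply] at hx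
  by_contra hx0
  have hpos := (posDef_map_ofReal_iff.2 hτ.2).dotProduct_mulVec_pos hx0
  have h := congrArg (fun K => star x ⬝ᵥ (K *ᵥ x)) (denom_conjTranspose_mul_num hM τ)
  simp only [sub_conjTranspose_eq hτ.1, sub_mulVec, ← mulVec_mulVec, hx, mulVec_zero,
    sub_zero, smul_mulVec, dotProduct_smul] at h
  rw [dotProduct_mulVec, ← star_mulVec, hx] at h
  simp at h
  exact hpos.ne' h

theorem act_mul_denom {M : Matrix (Fin g ⊕ Fin g) (Fin g ⊕ Fin g) ℤ}
    (hM : M ∈ symplecticGroup (Fin g) ℤ) {τ : Matrix (Fin g) (Fin g) ℂ} (hτ : IsSiegel τ) :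
    act M τ * denom M τ = num M τ := by
  rw [act, Matrix.mul_assoc, nonsing_inv_mul _ ((isUnit_iff_isUnit_det _).1 (isUnit_denom hM hτ)),
    Matrix.mul_one]

theorem isSiegel_act {M : Matrix (Fin g ⊕ Fin g) (Fin g ⊕ Fin g) ℤ}
    (hM : M ∈ symplecticGroup (Fin g) ℤ) {τ : Matrix (Fin g) (Fin g) ℂ} (hτ : IsSiegel τ) :
    IsSiegel (act M τ) := by
  have hu := isUnit_denom hM hτ
  have hmul := act_mul_denom hM hτ
  have hsymm : (act M τ).IsSymm := by
    have h := num_transpose_mul_denom hM hτ.1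
    rw [← hmul, transpose_mul, Matrix.mul_assoc, ← Matrix.mul_assoc] at h
    have hT : IsUnit (denom M τ)ᵀ := (isUnit_transpose _).2 hu
    rw [← Matrix.mul_assoc] at h
    have h' := hu.mul_right_cancel h
    exact hT.mul_left_cancel h'
  refine ⟨hsymm, ?_⟩
  rw [← posDef_map_ofReal_iff, ← hu.posDef_star_left_conjugate_iff]
  have h := denom_conjTranspose_mul_num hM τ
  rw [← hmul, conjTranspose_mul, ← Matrix.mul_assoc, ← Matrix.sub_mul, ← Matrix.mul_sub,
    sub_conjTranspose_eq hsymm, sub_conjTranspose_eq hτ.1, Matrix.mul_smul, Matrix.smul_mul] at h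
  rw [star_eq_conjTranspose, smul_right_injective _ (by simp : (2 * I : ℂ) ≠ 0) h]
  exact posDef_map_ofReal_iff.2 hτ.2

theorem map_intCast_mul_add_mul (A B C D : Matrix (Fin g) (Fin g) ℤ) :
    (A * B + C * D).map (Int.cast : ℤ → ℂ) = A.map (Int.cast : ℤ → ℂ) * B.map (Int.cast : ℤ → ℂ) +
      C.map (Int.cast : ℤ → ℂ) * D.map (Int.cast : ℤ → ℂ) := by
  ext i j
  simp [mul_apply]

theorem denom_mul {M N : Matrix (Fin g ⊕ Fin g) (Fin g ⊕ Fin g) ℤ}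
    (hN : N ∈ symplecticGroup (Fin g) ℤ) {τ : Matrix (Fin g) (Fin g) ℂ} (hτ : IsSiegel τ) :
    denom (M * N) τ = denom M (act N τ) * denom N τ := by
  have h := act_mul_denom hN hτ
  rw [denom.eq_1 M (act N τ), Matrix.add_mul, Matrix.mul_assoc, h]
  conv_lhs => rw [← fromBlocks_toBlocks M, ← fromBlocks_toBlocks N, fromBlocks_multiply]
  simp only [denom, num, toBlocks_fromBlocks₂₁, toBlocks_fromBlocks₂₂, map_intCast_mul_add_mul]
  noncomm_ring

theorem num_mul {M N : Matrix (Fin g ⊕ Fin g) (Fin g ⊕ Fin g) ℤ}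
    (hN : N ∈ symplecticGroup (Fin g) ℤ) {τ : Matrix (Fin g) (Fin g) ℂ} (hτ : IsSiegel τ) :
    num (M * N) τ = num M (act N τ) * denom N τ := by
  have h := act_mul_denom hN hτ
  rw [num.eq_1 M (act N τ), Matrix.add_mul, Matrix.mul_assoc, h]
  conv_lhs => rw [← fromBlocks_toBlocks M, ← fromBlocks_toBlocks N, fromBlocks_multiply]
  simp only [denom, num, toBlocks_fromBlocks₁₁, toBlocks_fromBlocks₁₂, map_intCast_mul_add_mul]
  noncomm_ring

theorem act_mul {M N : Matrix (Fin g ⊕ Fin g) (Fin g ⊕ Fin g) ℤ}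
    (hN : N ∈ symplecticGroup (Fin g) ℤ) {τ : Matrix (Fin g) (Fin g) ℂ} (hτ : IsSiegel τ) :
    act (M * N) τ = act M (act N τ) := by
  have hd := (isUnit_iff_isUnit_det _).1 (isUnit_denom hN hτ)
  rw [act, num_mul hN hτ, denom_mul hN hτ, Matrix.mul_inv_rev, Matrix.mul_assoc,
    ← Matrix.mul_assoc (denom N τ), mul_nonsing_inv _ hd, Matrix.one_mul, ← act]

end SiegelAction
/-! ### The affine action on characteristics modulo 2 -/

namespace CharAction

open Matrix

variable {g : ℕ}

theorem sum_sum_eq_of_symm {R : Type*} [CommRing R] (f : Fin g → Fin g → R)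
    (hf : ∀ i j, f i j = f j i) :
    ∑ i, ∑ j, f i j = 2 * (∑ i, ∑ j, if i < j then f i j else 0) + ∑ i, f i i := by
  have h : ∀ i j, f i j = (if i < j then f i j else 0) + (if j < i then f j i else 0) +
      if i = j then f i i else 0 := fun i j => by
    rcases lt_trichotomy i j with h | h | h
    · simp [h, h.not_gt, h.ne]
    · simp [h]
    · simp [h, h.not_gt, h.ne', hf i j]
  have h2 : ∑ i, ∑ j, (if j < i then f j i else 0) = ∑ i, ∑ j, if i < j then f i j else 0 :=
    Finset.sum_comm
  calc ∑ i, ∑ j, f i j = ∑ i, ∑ j, ((if i < j then f i j else 0) + (if j < i then f j i else 0) +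
        if i = j then f i i else 0) :=
        Finset.sum_congr rfl fun i _ => Finset.sum_congr rfl fun j _ => h i j
    _ = _ := by
        simp only [Finset.sum_add_distrib, h2, Finset.sum_ite_eq, Finset.mem_univ, if_true]
        ring

theorem diag_conj (p S : Matrix (Fin g) (Fin g) (ZMod 2)) (hS : S.IsSymm) :
    (p * S * pᵀ).diag = p *ᵥ S.diag := by
  ext i
  have h := sum_sum_eq_of_symm (fun j k => p i j * S j k * p i k)
    (fun j k => by rw [hS.apply j k]; ring)
  rw [(by decide : (2 : ZMod 2) = 0), zero_mul, zero_add] at h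
  simp only [diag_apply, mul_apply, transpose_apply, Finset.sum_mul, mulVec, dotProduct]
  rw [Finset.sum_comm, h]
  refine Finset.sum_congr rfl fun j _ => ?_
  have : ∀ x : ZMod 2, x * x = x := by decide
  rw [mul_right_comm, this]

theorem diag_mul_transpose (p q a b c d : Matrix (Fin g) (Fin g) (ZMod 2))
    (hab : a * bᵀ = b * aᵀ) (hcd : c * dᵀ = d * cᵀ) (h : a * dᵀ - b * cᵀ = 1) :
    ((p * a + q * c) * (p * b + q * d)ᵀ).diag =
      p *ᵥ (a * bᵀ).diag + q *ᵥ (c * dᵀ).diag + (p * qᵀ).diag := by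
  have h1 : (a * bᵀ).IsSymm := by rw [IsSymm, transpose_mul, transpose_transpose, hab]
  have h2 : (c * dᵀ).IsSymm := by rw [IsSymm, transpose_mul, transpose_transpose, hcd]
  rw [← diag_conj p _ h1, ← diag_conj q _ h2]
  have h3 : (q * c * (bᵀ * pᵀ)).diag = (-(p * b * (cᵀ * qᵀ))).diag := by
    rw [← diag_transpose]
    ext i
    simp only [transpose_mul, transpose_transpose, diag_apply, ZModModule.neg_eq_self,
      Matrix.mul_assoc]
  have h4 : ((p * a + q * c) * (p * b + q * d)ᵀ) = p * (a * bᵀ) * pᵀ + q * (c * dᵀ) * qᵀ +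
      p * a * (dᵀ * qᵀ) + q * c * (bᵀ * pᵀ) := by
    simp only [transpose_add, transpose_mul]
    noncomm_ring
  have h5 : p * qᵀ = p * (a * dᵀ - b * cᵀ) * qᵀ := by rw [h, Matrix.mul_one]
  rw [h5, h4, diag_add, h3, ← diag_add, ← diag_add, ← diag_add]
  congr 1
  noncomm_ring

/-- Reduction modulo 2. -/
def red (X : Matrix (Fin g) (Fin g) ℤ) : Matrix (Fin g) (Fin g) (ZMod 2) :=
  X.map (Int.cast : ℤ → ZMod 2)

/-- The upper half of the image of the characteristic `[u; v]` under the affine action of `M`. -/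
def top (M : Matrix (Fin g ⊕ Fin g) (Fin g ⊕ Fin g) ℤ) (u v : Fin g → ZMod 2) :
    Fin g → ZMod 2 :=
  red M.toBlocks₂₂ *ᵥ u + red M.toBlocks₂₁ *ᵥ v +
    (red M.toBlocks₂₁ * (red M.toBlocks₂₂)ᵀ).diag

/-- The lower half of the image of the characteristic `[u; v]` under the affine action of `M`. -/
def bot (M : Matrix (Fin g ⊕ Fin g) (Fin g ⊕ Fin g) ℤ) (u v : Fin g → ZMod 2) :
    Fin g → ZMod 2 :=
  red M.toBlocks₁₂ *ᵥ u + red M.toBlocks₁₁ *ᵥ v +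
    (red M.toBlocks₁₁ * (red M.toBlocks₁₂)ᵀ).diag

theorem red_mul_add_mul (A B C D : Matrix (Fin g) (Fin g) ℤ) :
    red (A * B + C * D) = red A * red B + red C * red D := by
  ext i j
  simp [red, mul_apply]

theorem red_blocks_of_mem {N : Matrix (Fin g ⊕ Fin g) (Fin g ⊕ Fin g) ℤ}
    (hN : N ∈ symplecticGroup (Fin g) ℤ) :
    red N.toBlocks₁₁ * (red N.toBlocks₁₂)ᵀ = red N.toBlocks₁₂ * (red N.toBlocks₁₁)ᵀ ∧
      red N.toBlocks₂₁ * (red N.toBlocks₂₂)ᵀ = red N.toBlocks₂₂ * (red N.toBlocks₂₁)ᵀ ∧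
      red N.toBlocks₁₁ * (red N.toBlocks₂₂)ᵀ - red N.toBlocks₁₂ * (red N.toBlocks₂₁)ᵀ = 1 := by
  have h := SymplecticGroup.transpose_mem hN
  rw [← fromBlocks_toBlocks N, fromBlocks_transpose, SymplecticGroup.fromBlocks_mem_iff] at h
  simp only [transpose_transpose] at h
  obtain ⟨h1, h2, h3⟩ := h
  have hmul : ∀ X Y : Matrix (Fin g) (Fin g) ℤ, red X * (red Y)ᵀ = red (X * Yᵀ) := fun X Y => by
    rw [red, red, ← transpose_map]
    exact (Matrix.map_mul (f := Int.castRingHom (ZMod 2))).symm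
  refine ⟨by rw [hmul, hmul, h1], by rw [hmul, hmul, h2], ?_⟩
  rw [hmul, hmul, red, red, ← Matrix.map_sub _ (by simp), h3]
  exact Matrix.map_one _ (by simp) (by simp)

theorem top_mul (M : Matrix (Fin g ⊕ Fin g) (Fin g ⊕ Fin g) ℤ)
    {N : Matrix (Fin g ⊕ Fin g) (Fin g ⊕ Fin g) ℤ}
    (hN : N ∈ symplecticGroup (Fin g) ℤ) (u v : Fin g → ZMod 2) :
    top (M * N) u v = top M (top N u v) (bot N u v) := by
  obtain ⟨h1, h2, h3⟩ := red_blocks_of_mem hN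
  have h := diag_mul_transpose (red M.toBlocks₂₁) (red M.toBlocks₂₂) _ _ _ _ h1 h2 h3
  conv_lhs => rw [← fromBlocks_toBlocks M, ← fromBlocks_toBlocks N, fromBlocks_multiply]
  simp only [top, bot, toBlocks_fromBlocks₂₁, toBlocks_fromBlocks₂₂, red_mul_add_mul, h,
    mulVec_add, add_mulVec, mulVec_mulVec]
  abel

theorem bot_mul (M : Matrix (Fin g ⊕ Fin g) (Fin g ⊕ Fin g) ℤ)
    {N : Matrix (Fin g ⊕ Fin g) (Fin g ⊕ Fin g) ℤ}
    (hN : N ∈ symplecticGroup (Fin g) ℤ) (u v : Fin g → ZMod 2) :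
    bot (M * N) u v = bot M (top N u v) (bot N u v) := by
  obtain ⟨h1, h2, h3⟩ := red_blocks_of_mem hN
  have h := diag_mul_transpose (red M.toBlocks₁₁) (red M.toBlocks₁₂) _ _ _ _ h1 h2 h3
  conv_lhs => rw [← fromBlocks_toBlocks M, ← fromBlocks_toBlocks N, fromBlocks_multiply]
  simp only [top, bot, toBlocks_fromBlocks₁₁, toBlocks_fromBlocks₁₂, red_mul_add_mul, h,
    mulVec_add, add_mulVec, mulVec_mulVec]
  abel

end CharAction

/-! ### Theta constants with half-integral characteristics -/

namespace ThetaConstant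

open Matrix Complex Real

variable {g : ℕ}

/-- The entries of an integral vector, as complex numbers. -/
def toComplex (y : Fin g → ℤ) : Fin g → ℂ := fun i => y i

/-- The term of a theta series with half-integral characteristic at `y / 2`. -/
def term (q y : Fin g → ℤ) (τ : Matrix (Fin g) (Fin g) ℂ) : ℂ :=
  cexp (π * I / 4 * (toComplex y ⬝ᵥ τ *ᵥ toComplex y + 2 * (toComplex y ⬝ᵥ toComplex q)))

/-- The theta constant with characteristic `[p / 2; q / 2]`. -/
def halfTheta (p q : Fin g → ℤ) (τ : Matrix (Fin g) (Fin g) ℂ) : ℂ :=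
  ∑' n : Fin g → ℤ, term q (2 • n + p) τ

theorem summable_gaussian {c : ℝ} (hc : 0 < c) (p : ℤ) :
    Summable fun n : ℤ => rexp (-c * ((2 * n + p : ℤ) : ℝ) ^ 2) := by
  have him : 0 < ((4 * c / π : ℝ) * I : ℂ).im := by
    simp only [im_ofReal_mul, I_im, mul_one]
    positivity
  have h := ((summable_jacobiTheta₂_term_iff ((2 * c * p / π : ℝ) * I) _).2 him).norm
  refine (h.mul_left (rexp (-c * (p : ℝ) ^ 2))).congr fun n => ?_
  rw [norm_jacobiTheta₂_term, ← Real.exp_add]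
  congr 1
  simp only [im_ofReal_mul, I_im, mul_one]
  push_cast
  field_simp
  ring

theorem summable_prod_pi {f : Fin g → ℤ → ℝ} (hf : ∀ i n, 0 ≤ f i n)
    (h : ∀ i, Summable (f i)) : Summable fun n : Fin g → ℤ => ∏ i, f i (n i) := by
  induction g with
  | zero => exact (hasSum_fintype _).summable
  | succ g ih =>
    have h1 := (h 0).mul_of_nonneg (ih (fun i => hf i.succ) fun i => h i.succ) (hf 0)
      fun n => Finset.prod_nonneg fun i _ => hf i.succ _
    refine ((Fin.consEquiv fun _ : Fin (g + 1) => ℤ).summable_iff).1 (h1.congr fun n => ?_)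
    simp [Fin.prod_univ_succ, Fin.consEquiv]

open scoped MatrixOrder in
theorem exists_le_dotProduct_mulVec {Y : Matrix (Fin g) (Fin g) ℝ} (hY : Y.PosDef) :
    ∃ c > 0, ∀ x : Fin g → ℝ, c * ∑ i, x i ^ 2 ≤ x ⬝ᵥ Y *ᵥ x := by
  rcases isEmpty_or_nonempty (Fin g) with hg | hg
  · exact ⟨1, one_pos, fun x => by simp [dotProduct]⟩
  obtain ⟨c, hc, h⟩ := (CFC.exists_pos_algebraMap_le_iff hY.isHermitian).2
    fun x hx => hY.isStrictlyPositive.spectrum_pos hx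
  refine ⟨c, hc, fun x => ?_⟩
  have h1 := (Matrix.le_iff.1 h).dotProduct_mulVec_nonneg x
  rw [sub_mulVec, dotProduct_sub, sub_nonneg, Algebra.algebraMap_eq_smul_one, smul_mulVec,
    one_mulVec, dotProduct_smul, smul_eq_mul] at h1
  simpa [dotProduct, sq] using h1

theorem norm_term (q y : Fin g → ℤ) (τ : Matrix (Fin g) (Fin g) ℂ) :
    ‖term q y τ‖ = rexp (-(π / 4) *
      ((fun i => (y i : ℝ)) ⬝ᵥ τ.map Complex.im *ᵥ fun i => (y i : ℝ))) := by
  rw [term, Complex.norm_exp]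
  congr 1
  have h1 : (toComplex y ⬝ᵥ toComplex q).im = 0 := by
    simp [dotProduct, toComplex]
  have h2 : (toComplex y ⬝ᵥ τ *ᵥ toComplex y).im =
      (fun i => (y i : ℝ)) ⬝ᵥ τ.map Complex.im *ᵥ fun i => (y i : ℝ) := by
    simp [dotProduct, mulVec, toComplex]
  rw [← h2, (by push_cast; ring : (π * I / 4 : ℂ) = (π / 4 : ℝ) * I), mul_assoc, re_ofReal_mul,
    I_mul_re, add_im, mul_im, h1]
  simp

theorem summable_term {τ : Matrix (Fin g) (Fin g) ℂ} (hτ : IsSiegel τ) (p q : Fin g → ℤ) :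
    Summable fun n : Fin g → ℤ => term q (2 • n + p) τ := by
  obtain ⟨c, hc, h⟩ := exists_le_dotProduct_mulVec hτ.2
  refine Summable.of_norm_bounded (summable_prod_pi (fun i n => (Real.exp_pos _).le) fun i =>
    summable_gaussian (c := π / 4 * c) (by positivity) (p i)) fun n => ?_
  rw [norm_term, ← Real.exp_sum, Real.exp_le_exp, ← Finset.mul_sum]
  have h2 : ∀ i, 2 * n i + p i = (2 • n + p) i := fun i => by simp
  simp only [h2]
  nlinarith [mul_le_mul_of_nonneg_left (h fun i => ((2 • n + p) i : ℝ)) Real.pi_pos.le]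

theorem term_add_lower (q y k : Fin g → ℤ) (τ : Matrix (Fin g) (Fin g) ℂ) :
    term (q + 2 • k) y τ = cexp (π * I * (y ⬝ᵥ k : ℤ)) * term q y τ := by
  rw [term, term, ← Complex.exp_add]
  congr 1
  have : toComplex y ⬝ᵥ toComplex (q + 2 • k) =
      toComplex y ⬝ᵥ toComplex q + 2 * (y ⬝ᵥ k : ℤ) := by
    simp only [dotProduct, toComplex, Pi.add_apply, Pi.smul_apply, Int.cast_sum, Finset.mul_sum,
      ← Finset.sum_add_distrib]
    refine Finset.sum_congr rfl fun i _ => ?_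
    simp only [nsmul_eq_mul]
    push_cast
    ring
  rw [this]
  ring

theorem exp_pi_mul_I_mul_even {m : ℤ} (hm : Even m) (z : ℂ) :
    cexp (π * I * m + z) = cexp z := by
  obtain ⟨k, rfl⟩ := hm
  rw [add_comm, Complex.exp_eq_exp_iff_exists_int]
  exact ⟨k, by push_cast; ring⟩

theorem halfTheta_add_lower (p q k : Fin g → ℤ) (τ : Matrix (Fin g) (Fin g) ℂ) :
    halfTheta p (q + 2 • k) τ = cexp (π * I * (p ⬝ᵥ k : ℤ)) * halfTheta p q τ := by
  rw [halfTheta, halfTheta, ← tsum_mul_left]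
  refine tsum_congr fun n => ?_
  rw [term_add_lower]
  congr 1
  have : (((2 • n + p) ⬝ᵥ k : ℤ) : ℂ) = (2 * (n ⬝ᵥ k) : ℤ) + (p ⬝ᵥ k : ℤ) := by
    rw [add_dotProduct, smul_dotProduct]; push_cast; simp
  rw [this, mul_add]
  exact exp_pi_mul_I_mul_even (even_two_mul _) _

theorem halfTheta_add_upper (p q k : Fin g → ℤ) (τ : Matrix (Fin g) (Fin g) ℂ) :
    halfTheta (p + 2 • k) q τ = halfTheta p q τ := by
  rw [halfTheta, halfTheta, ← (Equiv.addRight k).tsum_eq fun n => term q (2 • n + p) τ]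
  refine tsum_congr fun n => ?_
  congr 1
  simp only [Equiv.coe_addRight, smul_add]
  abel

/-- The eighth power of the theta constant with characteristic `[u / 2; v / 2]`. -/
def theta8 (u v : Fin g → ZMod 2) (τ : Matrix (Fin g) (Fin g) ℂ) : ℂ :=
  halfTheta (fun i => ((u i).val : ℤ)) (fun i => ((v i).val : ℤ)) τ ^ 8

/-- Reduction modulo 2 of an integral vector. -/
def mod2 (p : Fin g → ℤ) : Fin g → ZMod 2 := fun i => p i

theorem theta8_mod2 (p q : Fin g → ℤ) (τ : Matrix (Fin g) (Fin g) ℂ) :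
    theta8 (mod2 p) (mod2 q) τ = halfTheta p q τ ^ 8 := by
  have key : ∀ m : ℤ, m = ((m : ZMod 2).val : ℤ) + 2 * (m / 2) := fun m => by
    rw [ZMod.val_intCast]
    exact (Int.emod_add_mul_ediv m 2).symm
  have h : ∀ r : Fin g → ℤ, r = (fun i => ((r i : ZMod 2).val : ℤ)) + 2 • fun i => r i / 2 :=
    fun r => by
      ext i
      simpa using key (r i)
  conv_rhs => rw [h p, h q, halfTheta_add_upper, halfTheta_add_lower, mul_pow, ← Complex.exp_nat_mul]
  simp only [theta8, mod2]
  symm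
  convert one_mul _
  rw [Complex.exp_eq_one_iff]
  exact ⟨4 * _, by push_cast; ring⟩


theorem even_dotProduct_mulVec_add {S : Matrix (Fin g) (Fin g) ℤ} (hS : S.IsSymm)
    (n : Fin g → ℤ) : Even (n ⬝ᵥ S *ᵥ n + n ⬝ᵥ S.diag) := by
  have h := CharAction.sum_sum_eq_of_symm (fun j k => n j * (S j k * n k))
    (fun j k => by rw [hS.apply j k]; ring)
  have h2 : n ⬝ᵥ S *ᵥ n = ∑ i, ∑ j, n i * (S i j * n j) := by
    simp only [dotProduct, mulVec, Finset.mul_sum]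
  rw [h2, h, add_assoc, dotProduct, ← Finset.sum_add_distrib]
  refine (even_two_mul _).add (Finset.even_sum _ fun i _ => ?_)
  rw [diag_apply, ← mul_add, mul_comm (S i i), ← add_one_mul, ← mul_assoc]
  exact (Int.even_mul_succ_self _).mul_right _

theorem toComplex_dotProduct (x y : Fin g → ℤ) :
    toComplex x ⬝ᵥ toComplex y = ((x ⬝ᵥ y : ℤ) : ℂ) := by
  simp [dotProduct, toComplex]

theorem map_mulVec_toComplex (S : Matrix (Fin g) (Fin g) ℤ) (y : Fin g → ℤ) :
    S.map (Int.cast : ℤ → ℂ) *ᵥ toComplex y = toComplex (S *ᵥ y) := by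
  ext i
  simp [dotProduct, mulVec, toComplex]

theorem term_upper {S : Matrix (Fin g) (Fin g) ℤ} (hS : S.IsSymm) (p q n : Fin g → ℤ)
    (τ : Matrix (Fin g) (Fin g) ℂ) :
    term (q + S *ᵥ p + S.diag) (2 • n + p) (τ + S.map (Int.cast : ℤ → ℂ)) =
      cexp (π * I / 4 * (3 * (p ⬝ᵥ S *ᵥ p) + 2 * (p ⬝ᵥ S.diag) : ℤ)) *
        term q (2 • n + p) τ := by
  obtain ⟨k, hk⟩ := even_dotProduct_mulVec_add hS n
  rw [term, term, ← Complex.exp_add, Complex.exp_eq_exp_iff_exists_int]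
  refine ⟨k + n ⬝ᵥ S *ᵥ p, ?_⟩
  rw [add_mulVec, dotProduct_add, map_mulVec_toComplex]
  simp only [toComplex_dotProduct]
  have hsymm : p ⬝ᵥ S *ᵥ n = n ⬝ᵥ S *ᵥ p := by
    rw [dotProduct_mulVec, ← mulVec_transpose, hS.eq, dotProduct_comm]
  have h : (2 • n + p) ⬝ᵥ S *ᵥ (2 • n + p) + 2 * ((2 • n + p) ⬝ᵥ (q + S *ᵥ p + S.diag)) =
      8 * (k + n ⬝ᵥ S *ᵥ p) + (3 * (p ⬝ᵥ S *ᵥ p) + 2 * (p ⬝ᵥ S.diag)) +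
        2 * ((2 • n + p) ⬝ᵥ q) := by
    simp only [mulVec_add, mulVec_smul, dotProduct_add, add_dotProduct, smul_dotProduct,
      dotProduct_smul, hsymm]
    simp only [nsmul_eq_mul]
    push_cast
    linear_combination 4 * hk
  have h' := congrArg (Int.cast : ℤ → ℂ) h
  push_cast at h' ⊢
  linear_combination (π * I / 4) * h'

theorem halfTheta_upper {S : Matrix (Fin g) (Fin g) ℤ} (hS : S.IsSymm) (p q : Fin g → ℤ)
    (τ : Matrix (Fin g) (Fin g) ℂ) :
    halfTheta p (q + S *ᵥ p + S.diag) (τ + S.map (Int.cast : ℤ → ℂ)) ^ 8 =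
      halfTheta p q τ ^ 8 := by
  simp only [halfTheta, term_upper hS, tsum_mul_left]
  rw [mul_pow, ← Complex.exp_nat_mul]
  convert one_mul _
  rw [Complex.exp_eq_one_iff]
  exact ⟨3 * (p ⬝ᵥ S *ᵥ p) + 2 * (p ⬝ᵥ S.diag), by push_cast; ring⟩

theorem halfTheta_levi {U V : Matrix (Fin g) (Fin g) ℤ} (h : U * V = 1) (p q : Fin g → ℤ)
    (τ : Matrix (Fin g) (Fin g) ℂ) :
    halfTheta (Vᵀ *ᵥ p) (U *ᵥ q)
      (U.map (Int.cast : ℤ → ℂ) * τ * (U.map (Int.cast : ℤ → ℂ))ᵀ) = halfTheta p q τ := by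
  have h1 : V * U = 1 := mul_eq_one_comm.1 h
  have h2 : Uᵀ * Vᵀ = 1 := by rw [← transpose_mul, h1, transpose_one]
  have h3 : Vᵀ * Uᵀ = 1 := by rw [← transpose_mul, h, transpose_one]
  let e : (Fin g → ℤ) ≃ (Fin g → ℤ) :=
    { toFun := fun n => Vᵀ *ᵥ n
      invFun := fun n => Uᵀ *ᵥ n
      left_inv := fun n => by simp only [mulVec_mulVec, h2, one_mulVec]
      right_inv := fun n => by simp only [mulVec_mulVec, h3, one_mulVec] }
  rw [halfTheta, halfTheta, ← e.tsum_eq]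
  refine tsum_congr fun n => ?_
  have h4 : 2 • e n + Vᵀ *ᵥ p = Vᵀ *ᵥ (2 • n + p) := by
    simp only [e, Equiv.coe_fn_mk, mulVec_add, mulVec_smul]
  rw [h4, term, term]
  congr 2
  have h5 : toComplex (Vᵀ *ᵥ (2 • n + p)) ⬝ᵥ toComplex (U *ᵥ q) =
      toComplex (2 • n + p) ⬝ᵥ toComplex q := by
    rw [toComplex_dotProduct, toComplex_dotProduct, mulVec_transpose, ← dotProduct_mulVec,
      mulVec_mulVec, h1, one_mulVec]
  have h6 : (U.map (Int.cast : ℤ → ℂ))ᵀ *ᵥ toComplex (Vᵀ *ᵥ (2 • n + p)) =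
      toComplex (2 • n + p) := by
    rw [← transpose_map, map_mulVec_toComplex, mulVec_mulVec, h2, one_mulVec]
  rw [h5, ← mulVec_mulVec, h6, ← mulVec_mulVec, dotProduct_mulVec, ← mulVec_transpose, h6]

/-- The one-variable inversion formula, in the shape of a summand of a theta constant. -/
theorem tsum_inversion (p q : ℤ) (w : ℂ) {t : ℂ} (ht : t ≠ 0) :
    ∑' k : ℤ, cexp (π * I / 4 * (2 * (2 * k + p) * w + (2 * k + p) ^ 2 * t +
        2 * ((2 * k + p) * q))) =
      1 / (-I * t) ^ (1 / 2 : ℂ) * cexp (π * I / 2 * (p * q)) *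
        ∑' k : ℤ, cexp (π * I / 4 * (-w ^ 2 / t + 2 * (2 * k - q) * (w / t) +
          (2 * k - q) ^ 2 * (-1 / t) + 2 * ((2 * k - q) * p))) := by
  have h := jacobiTheta₂_functional_equation ((w + p * t + q) / 2) t
  have h1 : ∀ k : ℤ, cexp (π * I / 4 * (2 * (2 * k + p) * w + (2 * k + p) ^ 2 * t +
      2 * ((2 * k + p) * q))) = cexp (π * I / 4 * (2 * p * w + p ^ 2 * t + 2 * p * q)) *
        jacobiTheta₂_term k ((w + p * t + q) / 2) t := fun k => by
    rw [jacobiTheta₂_term, ← Complex.exp_add]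
    ring_nf
  have h2 : ∀ k : ℤ, cexp (π * I / 2 * (p * q)) * cexp (π * I / 4 * (-w ^ 2 / t +
      2 * (2 * k - q) * (w / t) + (2 * k - q) ^ 2 * (-1 / t) + 2 * ((2 * k - q) * p))) =
      cexp (π * I / 4 * (2 * p * w + p ^ 2 * t + 2 * p * q)) *
        (cexp (-π * I * ((w + p * t + q) / 2) ^ 2 / t) *
        jacobiTheta₂_term k ((w + p * t + q) / 2 / t) (-1 / t)) := fun k => by
    rw [jacobiTheta₂_term, ← Complex.exp_add, ← Complex.exp_add, ← Complex.exp_add]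
    congr 1
    field_simp
    ring
  simp only [mul_assoc (1 / (-I * t) ^ (1 / 2 : ℂ)), ← tsum_mul_left, h1, h2] at h ⊢
  simp only [tsum_mul_left] at h ⊢
  rw [← jacobiTheta₂, ← jacobiTheta₂, h]
  ring

/-- Extension of an integral vector by zero in the `i`-th entry. -/
def extendZero (i : Fin g) (r : {j // j ≠ i} → ℤ) : Fin g → ℤ :=
  fun j => if h : j = i then 0 else r ⟨j, h⟩

theorem tsum_eq_tsum_tsum (i : Fin g) {f : (Fin g → ℤ) → ℂ} (hf : Summable f) :
    ∑' n, f n = ∑' r, ∑' k : ℤ, f (extendZero i r + Pi.single i k) := by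
  let e := (Equiv.prodComm ({j // j ≠ i} → ℤ) ℤ).trans (Equiv.funSplitAt i ℤ).symm
  have he : ∑' x, f (e x) = ∑' r, ∑' k, f (e (r, k)) :=
    ((e.summable_iff (f := f)).2 hf).tsum_prod
  rw [← e.tsum_eq, he]
  refine tsum_congr fun r => tsum_congr fun k => congrArg f ?_
  ext j
  by_cases h : j = i
  · subst h; simp [e, extendZero]
  · simp [e, extendZero, h]

theorem dotProduct_mulVec_add_single {τ : Matrix (Fin g) (Fin g) ℂ} (hτ : τ.IsSymm) (i : Fin g)
    (y : Fin g → ℂ) (s : ℂ) :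
    (y + Pi.single i s) ⬝ᵥ τ *ᵥ (y + Pi.single i s) =
      y ⬝ᵥ τ *ᵥ y + 2 * s * (τ *ᵥ y) i + s ^ 2 * τ i i := by
  have h : y ⬝ᵥ τ *ᵥ Pi.single i s = s * (τ *ᵥ y) i := by
    rw [dotProduct_mulVec, ← mulVec_transpose, hτ.eq, dotProduct_single, mul_comm]
  rw [mulVec_add, add_dotProduct, dotProduct_add, dotProduct_add, h, single_dotProduct,
    single_dotProduct]
  simp only [mulVec_single, Pi.smul_apply, op_smul_eq_smul, col_apply, smul_eq_mul]
  ring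

open SymplecticReduction SiegelAction

theorem map_single_one (i : Fin g) :
    (single i i (1 : ℤ)).map (Int.cast : ℤ → ℂ) = single i i 1 := by
  ext j k
  simp [single_apply, apply_ite]

theorem map_one_sub_single (i : Fin g) :
    (1 - single i i (1 : ℤ)).map (Int.cast : ℤ → ℂ) = 1 - single i i 1 := by
  rw [Matrix.map_sub _ (by simp), map_single_one, Matrix.map_one _ (by simp) (by simp)]

theorem denom_inversion (τ : Matrix (Fin g) (Fin g) ℂ) (i : Fin g) :
    denom (inversion i) τ = single i i 1 * τ + (1 - single i i 1) := by
  rw [denom, inversion, toBlocks_fromBlocks₂₁, toBlocks_fromBlocks₂₂, map_single_one,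
    map_one_sub_single]

theorem num_inversion (τ : Matrix (Fin g) (Fin g) ℂ) (i : Fin g) :
    num (inversion i) τ = (1 - single i i 1) * τ - single i i 1 := by
  have h : (-single i i (1 : ℤ)).map (Int.cast : ℤ → ℂ) = -single i i 1 := by
    rw [← map_single_one]
    ext j k
    rw [map_apply, Matrix.neg_apply, Matrix.neg_apply, Int.cast_neg, map_apply]
  rw [num, inversion, toBlocks_fromBlocks₁₁, toBlocks_fromBlocks₁₂, map_one_sub_single, h,
    ← sub_eq_add_neg]

theorem inversion_mulVec {τ σ : Matrix (Fin g) (Fin g) ℂ} (i : Fin g)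
    (h : σ * denom (inversion i) τ = num (inversion i) τ) (y : Fin g → ℂ) :
    σ *ᵥ (y + Pi.single i ((τ *ᵥ y) i - y i)) = τ *ᵥ y - Pi.single i ((τ *ᵥ y) i + y i) := by
  have hE : ∀ v : Fin g → ℂ, single i i (1 : ℂ) *ᵥ v = Pi.single i (v i) := fun v => by
    ext j
    by_cases hj : j = i
    · subst hj; simp [mulVec, dotProduct, single_apply]
    · simp [mulVec, dotProduct, hj, Ne.symm hj]
  have h' := congrArg (· *ᵥ y) h
  simp only [denom_inversion, num_inversion, ← mulVec_mulVec, add_mulVec, sub_mulVec, one_mulVec,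
    hE] at h'
  rw [Pi.single_sub, Pi.single_add]
  convert h' using 1
  · congr 1; abel
  · abel

theorem det_denom_inversion (τ : Matrix (Fin g) (Fin g) ℂ) (i : Fin g) :
    (denom (inversion i) τ).det = τ i i := by
  have h : denom (inversion i) τ = (1 : Matrix (Fin g) (Fin g) ℂ)ᵀᵀ.updateRow i (τ i) := by
    rw [denom_inversion]
    ext j k
    rcases eq_or_ne j i with rfl | hj
    · simp [single_apply, one_apply]
    · simp [one_apply, hj, Ne.symm hj]
  rw [h, ← cramer_transpose_apply]
  simp

theorem halfTheta_inversion {τ σ : Matrix (Fin g) (Fin g) ℂ} (hτ : IsSiegel τ)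
    (hσ : IsSiegel σ) (i : Fin g) (h : σ * denom (inversion i) τ = num (inversion i) τ)
    (p q : Fin g → ℤ) :
    halfTheta p q τ = 1 / (-I * τ i i) ^ (1 / 2 : ℂ) * cexp (π * I / 2 * (p i * q i)) *
      halfTheta (Function.update p i (-q i)) (Function.update q i (p i)) σ := by
  have ht : τ i i ≠ 0 := fun h0 => by
    have := hτ.2.diag_pos (i := i)
    simp [h0] at this
  rw [halfTheta, halfTheta, tsum_eq_tsum_tsum i (summable_term hτ p q),
    tsum_eq_tsum_tsum i (summable_term hσ _ _), ← tsum_mul_left]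
  refine tsum_congr fun r => ?_
  set y : Fin g → ℤ := 2 • extendZero i r + p - Pi.single i (p i) with hy
  have hyi : toComplex y i = 0 := by simp [hy, toComplex, extendZero]
  have hp : ∀ k : ℤ, 2 • (extendZero i r + Pi.single i k) + p =
      y + Pi.single i (2 * k + p i) := fun k => by
    ext j
    rcases eq_or_ne j i with rfl | hj
    · simp [hy]; ring
    · simp [hy, hj]
  have hp' : ∀ k : ℤ, 2 • (extendZero i r + Pi.single i k) + Function.update p i (-q i) =
      y + Pi.single i (2 * k - q i) := fun k => by
    ext j
    rcases eq_or_ne j i with rfl | hj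
    · simp [hy, extendZero]; ring
    · simp [hy, hj]
  have hadd : ∀ s : ℤ, toComplex (y + Pi.single i s) = toComplex y + Pi.single i (s : ℂ) :=
    fun s => by
      ext j
      rcases eq_or_ne j i with rfl | hj
      · simp [toComplex]
      · simp [toComplex, hj]
  have hq : toComplex y ⬝ᵥ toComplex (Function.update q i (p i)) =
      toComplex y ⬝ᵥ toComplex q := by
    refine Finset.sum_congr rfl fun j _ => ?_
    rcases eq_or_ne j i with rfl | hj
    · simp [hyi]
    · simp [toComplex, hj]
  have hA := inversion_mulVec i h (toComplex y)
  have hB := congrFun (inversion_mulVec i h (Pi.single i 1)) i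
  have hσii : σ i i = -1 / τ i i := by
    rw [← Pi.single_add] at hB
    simp at hB
    field_simp
    linear_combination hB
  set w := (τ *ᵥ toComplex y) i with hw
  rw [hyi, sub_zero, add_zero] at hA
  have hσw : (σ *ᵥ toComplex y) i = w / τ i i := by
    have := congrFun hA i
    simp [mulVec_add, ← hw, hσii] at this
    field_simp at this ⊢
    linear_combination this
  have hσy : toComplex y ⬝ᵥ σ *ᵥ toComplex y =
      toComplex y ⬝ᵥ τ *ᵥ toComplex y - w ^ 2 / τ i i := by
    have := congrArg (toComplex y ⬝ᵥ ·) hA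
    simp only [mulVec_add, dotProduct_add, dotProduct_sub, dotProduct_single, hyi, zero_mul] at this
    rw [dotProduct_mulVec _ σ (Pi.single i w), ← mulVec_transpose, hσ.1.eq, dotProduct_single,
      hσw] at this
    linear_combination this
  have h1 : ∀ k : ℤ, term q (2 • (extendZero i r + Pi.single i k) + p) τ =
      cexp (π * I / 4 * (toComplex y ⬝ᵥ τ *ᵥ toComplex y + 2 * (toComplex y ⬝ᵥ toComplex q))) *
        cexp (π * I / 4 * (2 * (2 * k + p i) * w + (2 * k + p i) ^ 2 * τ i i +
          2 * ((2 * k + p i) * q i))) := fun k => by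
    rw [hp, term, hadd, dotProduct_mulVec_add_single hτ.1, add_dotProduct, single_dotProduct,
      ← Complex.exp_add, ← hw]
    congr 1
    simp only [toComplex]
    push_cast
    ring
  have h2 : ∀ k : ℤ, term (Function.update q i (p i)) (2 • (extendZero i r + Pi.single i k) +
      Function.update p i (-q i)) σ =
      cexp (π * I / 4 * (toComplex y ⬝ᵥ τ *ᵥ toComplex y + 2 * (toComplex y ⬝ᵥ toComplex q))) *
        cexp (π * I / 4 * (-w ^ 2 / τ i i + 2 * (2 * k - q i) * (w / τ i i) +
          (2 * k - q i) ^ 2 * (-1 / τ i i) + 2 * ((2 * k - q i) * p i))) := fun k => by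
    rw [hp', term, hadd, dotProduct_mulVec_add_single hσ.1, add_dotProduct, single_dotProduct,
      ← Complex.exp_add, hq, hσy, hσw, hσii]
    congr 1
    simp only [toComplex, Function.update_self]
    push_cast
    ring
  simp only [h1, h2, tsum_mul_left, tsum_inversion _ _ w ht]
  ring

theorem halfTheta_inversion_pow {τ σ : Matrix (Fin g) (Fin g) ℂ} (hτ : IsSiegel τ)
    (hσ : IsSiegel σ) (i : Fin g) (h : σ * denom (inversion i) τ = num (inversion i) τ)
    (p q : Fin g → ℤ) :
    halfTheta (Function.update p i (-q i)) (Function.update q i (p i)) σ ^ 8 =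
      τ i i ^ 4 * halfTheta p q τ ^ 8 := by
  have ht : τ i i ≠ 0 := fun h0 => by
    have := hτ.2.diag_pos (i := i)
    simp [h0] at this
  have h1 : ((-I * τ i i) ^ (1 / 2 : ℂ)) ^ 8 = τ i i ^ 4 := by
    rw [(by norm_num : (8 : ℕ) = 2 * 4), pow_mul, ← Complex.cpow_nat_mul]
    norm_num [mul_pow]
  have h2 : cexp (π * I / 2 * (p i * q i)) ^ 8 = 1 := by
    rw [← Complex.exp_nat_mul, Complex.exp_eq_one_iff]
    exact ⟨2 * (p i * q i), by push_cast; ring⟩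
  rw [halfTheta_inversion hτ hσ i h, mul_pow, mul_pow, div_pow, h1, h2]
  field_simp

theorem red_mulVec_mod2 (S : Matrix (Fin g) (Fin g) ℤ) (p : Fin g → ℤ) :
    CharAction.red S *ᵥ mod2 p = mod2 (S *ᵥ p) := by
  ext i
  simp [CharAction.red, mod2, mulVec, dotProduct]

theorem exists_mod2_eq (u : Fin g → ZMod 2) : ∃ p, mod2 p = u :=
  ⟨fun i => (u i).val, by ext i; simp [mod2]⟩

open CharAction

theorem red_one : red (1 : Matrix (Fin g) (Fin g) ℤ) = 1 := Matrix.map_one _ (by simp) (by simp)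

theorem red_zero : red (0 : Matrix (Fin g) (Fin g) ℤ) = 0 := Matrix.map_zero _ (by simp)

/-- The transformation law of the eighth powers of the theta constants. -/
theorem theta8_act {M : Matrix (Fin g ⊕ Fin g) (Fin g ⊕ Fin g) ℤ}
    (hM : M ∈ symplecticGroup (Fin g) ℤ) :
    ∀ τ, IsSiegel τ → ∀ u v : Fin g → ZMod 2,
      theta8 (top M u v) (bot M u v) (act M τ) = (denom M τ).det ^ 4 * theta8 u v τ := by
  refine symplectic_induction (P := fun M => ∀ τ, IsSiegel τ → ∀ u v : Fin g → ZMod 2,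
    theta8 (top M u v) (bot M u v) (act M τ) = (denom M τ).det ^ 4 * theta8 u v τ)
    ?_ ?_ ?_ ?_ M hM
  · intro M N hM hN ihM ihN τ hτ u v
    rw [top_mul M hN, bot_mul M hN, act_mul hN hτ, ihM _ (isSiegel_act hN hτ), ihN τ hτ,
      denom_mul hN hτ, det_mul, mul_pow, mul_assoc]
  · intro S hS τ hτ u v
    obtain ⟨p, rfl⟩ := exists_mod2_eq u
    obtain ⟨q, rfl⟩ := exists_mod2_eq v
    have hd : denom (upper S) τ = 1 := by
      simp [denom, upper]
    have ha : act (upper S) τ = τ + S.map (Int.cast : ℤ → ℂ) := by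
      rw [act, hd]
      simp [num, upper]
    have ht : top (upper S) (mod2 p) (mod2 q) = mod2 p := by
      simp [top, upper, red_one, red_zero]
    have hb : bot (upper S) (mod2 p) (mod2 q) = mod2 (q + S *ᵥ p + S.diag) := by
      simp only [bot, upper, toBlocks_fromBlocks₁₁, toBlocks_fromBlocks₁₂, red_mulVec_mod2, red_one,
        one_mulVec, Matrix.one_mul, diag_transpose]
      ext i
      simp [mod2, red]
      ring
    rw [ha, hd, ht, hb, det_one, one_pow, one_mul, theta8_mod2,
      theta8_mod2, halfTheta_upper hS]
  · intro U V h τ hτ u v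
    obtain ⟨p, rfl⟩ := exists_mod2_eq u
    obtain ⟨q, rfl⟩ := exists_mod2_eq v
    have hd : denom (levi U V) τ = Vᵀ.map (Int.cast : ℤ → ℂ) := by
      simp [denom, levi]
    have hUV : (Vᵀ.map (Int.cast : ℤ → ℂ)) * (U.map (Int.cast : ℤ → ℂ))ᵀ = 1 := by
      rw [← transpose_map, transpose_map, transpose_map, ← transpose_mul]
      have : U.map (Int.cast : ℤ → ℂ) * V.map (Int.cast : ℤ → ℂ) = 1 := by
        rw [← Matrix.map_one (Int.cast : ℤ → ℂ) (by simp) (by simp), ← h]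
        exact (Matrix.map_mul (f := Int.castRingHom ℂ)).symm
      rw [this, transpose_one]
    have ha : act (levi U V) τ =
        U.map (Int.cast : ℤ → ℂ) * τ * (U.map (Int.cast : ℤ → ℂ))ᵀ := by
      rw [act, hd, inv_eq_right_inv hUV]
      simp [num, levi]
    have ht : top (levi U V) (mod2 p) (mod2 q) = mod2 (Vᵀ *ᵥ p) := by
      simp [top, levi, red_zero, red_mulVec_mod2]
    have hb : bot (levi U V) (mod2 p) (mod2 q) = mod2 (U *ᵥ q) := by
      simp [bot, levi, red_zero, red_mulVec_mod2]
    have hdet : (Vᵀ.map (Int.cast : ℤ → ℂ)).det ^ 4 = 1 := by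
      have h1 : (Vᵀ.map (Int.cast : ℤ → ℂ)).det = (V.det : ℂ) := by
        rw [transpose_map, det_transpose]
        exact (RingHom.map_det (Int.castRingHom ℂ) V).symm
      have h2 : IsUnit V.det := isUnit_iff_exists_inv'.2 ⟨U.det, by rw [← det_mul, h, det_one]⟩
      rw [h1]
      rcases Int.isUnit_iff.1 h2 with h3 | h3 <;> norm_num [h3]
    rw [ha, hd, ht, hb, hdet, one_mul, theta8_mod2, theta8_mod2,
      halfTheta_levi h]
  · intro i τ hτ u v
    obtain ⟨p, rfl⟩ := exists_mod2_eq u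
    obtain ⟨q, rfl⟩ := exists_mod2_eq v
    have hM := inversion_mem i
    have hE : ∀ v : Fin g → ZMod 2, red (single i i 1) *ᵥ v = Pi.single i (v i) := fun v => by
      ext j
      rcases eq_or_ne j i with rfl | hj
      · simp [red, mulVec, dotProduct, single_apply, apply_ite]
      · simp [red, mulVec, dotProduct, hj, Ne.symm hj]
    have hsub : red (1 - single i i 1) = 1 - red (single i i 1) := by
      rw [← red_one]
      exact Matrix.map_sub _ (by simp) _ _
    have hneg : red (-single i i 1) = red (single i i 1) := by
      ext j k
      simp [red]
    have hT : (red (1 - single i i 1))ᵀ = red (1 - single i i 1) := by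
      rw [red, ← transpose_map, transpose_sub, transpose_one, transpose_single]
    have hT' : (red (single i i 1))ᵀ = red (single i i 1) := by
      rw [red, ← transpose_map, transpose_single]
    have hsq : red (single i i 1) * red (single i i 1) = red (single i i 1) := by
      have h := Matrix.map_mul (f := Int.castRingHom (ZMod 2)) (L := single i i 1)
        (M := single i i 1)
      rw [single_mul_single_same, one_mul] at h
      exact h.symm
    have ht : top (inversion i) (mod2 p) (mod2 q) = mod2 (Function.update p i (-q i)) := by
      simp only [top, inversion, toBlocks_fromBlocks₂₁, toBlocks_fromBlocks₂₂, hT]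
      simp only [hsub, sub_mulVec, one_mulVec, hE, Matrix.mul_sub, hsq, Matrix.mul_one, sub_self,
        diag_zero, add_zero]
      ext j
      rcases eq_or_ne j i with rfl | hj
      · simp [mod2]
      · simp [mod2, hj]
    have hb : bot (inversion i) (mod2 p) (mod2 q) = mod2 (Function.update q i (p i)) := by
      simp only [bot, inversion, toBlocks_fromBlocks₁₁, toBlocks_fromBlocks₁₂, hneg, hT']
      simp only [hsub, sub_mulVec, one_mulVec, hE, Matrix.sub_mul, hsq, Matrix.one_mul, sub_self,
        diag_zero, add_zero]
      ext j
      rcases eq_or_ne j i with rfl | hj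
      · simp [mod2]
      · simp [mod2, hj]
    rw [ht, hb, det_denom_inversion, theta8_mod2, theta8_mod2,
      halfTheta_inversion_pow hτ (isSiegel_act hM hτ) i (act_mul_denom hM hτ)]

theorem theta_half (p q : Fin g → ℤ) (τ : Matrix (Fin g) (Fin g) ℂ) :
    theta (fun i => (p i : ℝ) / 2, fun i => (q i : ℝ) / 2) 0 τ = halfTheta p q τ := by
  refine tsum_congr fun n => ?_
  rw [term]
  congr 1
  have h : ∀ i, toComplex (2 • n + p) i = 2 * ((n i : ℂ) + ((p i / 2 : ℝ) : ℂ)) := fun i => by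
    simp [toComplex]
    ring
  rw [mul_add]
  congr 1
  · simp only [dotProduct, mulVec, h, Finset.mul_sum]
    exact Finset.sum_congr rfl fun i _ => Finset.sum_congr rfl fun j _ => by ring
  · simp only [dotProduct, h, Finset.mul_sum]
    refine Finset.sum_congr rfl fun i _ => ?_
    simp [toComplex]
    ring

theorem exists_fract_sum_eq_half (s : Finset ℕ) (f : ℕ → ℝ) (hf : ∀ k, f k = 0 ∨ f k = 1 / 2) :
    ∃ m : ℤ, Int.fract (∑ k ∈ s, f k) = m / 2 := by
  have h : ∃ m : ℤ, ∑ k ∈ s, f k = m / 2 := by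
    refine Finset.sum_induction f (fun x : ℝ => ∃ m : ℤ, x = m / 2) ?_ ⟨0, by simp⟩ fun k _ => ?_
    · rintro _ _ ⟨a, rfl⟩ ⟨b, rfl⟩
      exact ⟨a + b, by push_cast; ring⟩
    · rcases hf k with h | h
      · exact ⟨0, by simp [h]⟩
      · exact ⟨1, by simp [h]⟩
  obtain ⟨m, hm⟩ := h
  refine ⟨m - 2 * ⌊∑ k ∈ s, f k⌋, ?_⟩
  rw [Int.fract]
  push_cast
  linear_combination hm

theorem exists_theta_etaSet_eq (S : Finset ℕ) :
    ∃ u v : Fin g → ZMod 2, ∀ τ, theta (etaSet g S) 0 τ ^ 8 = theta8 u v τ := by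
  choose p hp using fun i => exists_fract_sum_eq_half (S.erase (2 * g + 2))
    (fun k => (etaBase g k).1 i) fun k => by
      simp only [etaBase]; split_ifs <;> simp
  choose q hq using fun i => exists_fract_sum_eq_half (S.erase (2 * g + 2))
    (fun k => (etaBase g k).2 i) fun k => by
      simp only [etaBase]; split_ifs <;> simp
  refine ⟨mod2 p, mod2 q, fun τ => ?_⟩
  rw [theta8_mod2, ← theta_half, etaSet, funext hp, funext hq]

theorem phi_act {M : Matrix (Fin g ⊕ Fin g) (Fin g ⊕ Fin g) ℤ}
    (hM : M ∈ symplecticGroup (Fin g) ℤ) (ht : ∀ u v, top M u v = u) (hb : ∀ u v, bot M u v = v)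
    {τ : Matrix (Fin g) (Fin g) ℂ} (hτ : IsSiegel τ) :
    phi g (act M τ) = (denom M τ).det ^ (4 * (2 * g + 1).choose (g + 1)) * phi g τ := by
  have h : ∀ S, theta (etaSet g S) 0 (act M τ) ^ 8 =
      (denom M τ).det ^ 4 * theta (etaSet g S) 0 τ ^ 8 := fun S => by
    obtain ⟨u, v, huv⟩ := exists_theta_etaSet_eq (g := g) S
    have := theta8_act hM τ hτ u v
    rwa [ht, hb, ← huv, ← huv] at this
  simp only [phi, h, Finset.prod_mul_distrib, Finset.prod_const, Finset.card_powersetCard,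
    Nat.card_Icc, Nat.add_sub_cancel, pow_mul]

end ThetaConstant

/-- The modular discriminant `φ_g` is a modular form of weight `4r`,
`r = binom(2g+1, g+1)`, on `Γ_g(2)`: for `γ = (A B; C D) ∈ Sp(2g,ℤ)` with
`γ ≡ I_{2g} mod 2` and `τ ∈ H_g`, the matrix `Cτ + D` is invertible,
`γ·τ = (Aτ+B)(Cτ+D)⁻¹` lies in `H_g`, and
`φ_g(γ·τ) = det(Cτ+D)^{4r}·φ_g(τ)`. -/
theorem phi_modular (g : ℕ) (hg : 2 ≤ g)
    (A B C D : Matrix (Fin g) (Fin g) ℤ)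
    (hsp : SpBlocks g A B C D) (hmod : CongImod2 g A B C D)
    (τ : Matrix (Fin g) (Fin g) ℂ) (hτ : IsSiegel τ) :
    IsUnit (C.map (Int.cast : ℤ → ℂ) * τ + D.map (Int.cast : ℤ → ℂ)) ∧
      IsSiegel ((A.map (Int.cast : ℤ → ℂ) * τ + B.map (Int.cast : ℤ → ℂ)) *
        (C.map (Int.cast : ℤ → ℂ) * τ + D.map (Int.cast : ℤ → ℂ))⁻¹) ∧
      phi g ((A.map (Int.cast : ℤ → ℂ) * τ + B.map (Int.cast : ℤ → ℂ)) *
          (C.map (Int.cast : ℤ → ℂ) * τ + D.map (Int.cast : ℤ → ℂ))⁻¹) =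
        (C.map (Int.cast : ℤ → ℂ) * τ + D.map (Int.cast : ℤ → ℂ)).det ^
            (4 * (2 * g + 1).choose (g + 1)) * phi g τ := by
  have hM : Matrix.fromBlocks A B C D ∈ Matrix.symplecticGroup (Fin g) ℤ := by
    rw [SymplecticGroup.mem_iff']
    have hJ : Matrix.J (Fin g) ℤ = -Matrix.fromBlocks 0 1 (-1) 0 := by
      simp [Matrix.J, Matrix.fromBlocks_neg]
    rw [hJ, Matrix.mul_neg, Matrix.neg_mul, hsp]
  have hred : ∀ {a b : ℤ}, (2 : ℤ) ∣ a - b → (a : ZMod 2) = b := fun h =>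
    ((ZMod.intCast_eq_intCast_iff_dvd_sub _ _ 2).2 (by exact_mod_cast h)).symm
  have hA : CharAction.red A = 1 := by
    rw [← ThetaConstant.red_one]
    ext i j
    simpa [CharAction.red, Matrix.one_apply, apply_ite] using hred (hmod (.inl i) (.inl j))
  have hB : CharAction.red B = 0 := by
    ext i j
    simpa [CharAction.red] using hred (hmod (.inl i) (.inr j))
  have hC : CharAction.red C = 0 := by
    ext i j
    simpa [CharAction.red] using hred (hmod (.inr i) (.inl j))
  have hD : CharAction.red D = 1 := by
    rw [← ThetaConstant.red_one]
    ext i j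
    simpa [CharAction.red, Matrix.one_apply, apply_ite] using hred (hmod (.inr i) (.inr j))
  have h := ThetaConstant.phi_act hM (by simp [CharAction.top, hC, hD])
    (by simp [CharAction.bot, hA, hB]) hτ
  exact ⟨SiegelAction.isUnit_denom hM hτ, SiegelAction.isSiegel_act hM hτ, h⟩

end
end
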